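/- arXiv:1106.4386 — 10 statements merged into one kernel-verified Lean document; each statement's English description precedes it below -/
import Mathlib

section
/- Let J ≥ 1, let R ⊆ [0,∞)^J be a compact convex set, and assume each U_j is continuous on [0,∞) × [0,∞), satisfies (U1) U_j(0,c) = 0 for every c ≥ 0, and (U2) for every q > 0 the map c ↦ U_j(q,c) is strictly increasing and strictly concave on [0,∞). Let q^l → q in [0,∞)^J as l → ∞; for each l let Λ^l be a maximizer of c ↦ Σ_{j=1}^J U_j(q^l_j,c_j) over c ∈ R, and let Λ be a maximizer of c ↦ Σ_{j=1}^J U_j(q_j,c_j) over c ∈ R. Then Λ^l_j → Λ_j as l → ∞ for every j with q_j > 0. -/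
open Set Filter

/-- A sum of strictly concave functions and zero functions determines its maximizers over a convex
set in the strictly concave coordinates. -/
theorem maximizers_eq_of_strictConcaveOn {ι : Type*} [Fintype ι] {f : ι → ℝ → ℝ}
    {R : Set (ι → ℝ)} (hRsub : R ⊆ {c | ∀ j, 0 ≤ c j}) (hRconv : Convex ℝ R)
    (hf : ∀ j, StrictConcaveOn ℝ (Ici (0 : ℝ)) (f j) ∨ ∀ c, 0 ≤ c → f j c = 0)
    {x y : ι → ℝ} (hx : x ∈ R) (hy : y ∈ R)
    (hxmax : ∀ c ∈ R, ∑ j, f j (c j) ≤ ∑ j, f j (x j))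
    (hymax : ∀ c ∈ R, ∑ j, f j (c j) ≤ ∑ j, f j (y j))
    {i : ι} (hi : StrictConcaveOn ℝ (Ici (0 : ℝ)) (f i)) : x i = y i := by
  by_contra hne
  have hm : (1 / 2 : ℝ) • x + (1 / 2 : ℝ) • y ∈ R :=
    hRconv hx hy (by norm_num) (by norm_num) (by norm_num)
  have hlt : ∑ j, ((1 / 2 : ℝ) * f j (x j) + (1 / 2 : ℝ) * f j (y j)) <
      ∑ j, f j (((1 / 2 : ℝ) • x + (1 / 2 : ℝ) • y) j) := by
    refine Finset.sum_lt_sum (fun j _ => ?_) ⟨i, Finset.mem_univ i, ?_⟩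
    · rcases hf j with h | h
      · exact h.concaveOn.2 (hRsub hx j) (hRsub hy j) (by norm_num) (by norm_num) (by norm_num)
      · rw [h _ (hRsub hx j), h _ (hRsub hy j), h _ (hRsub hm j)]
        norm_num
    · exact hi.2 (hRsub hx i) (hRsub hy i) hne (by norm_num) (by norm_num) (by norm_num)
  rw [Finset.sum_add_distrib, ← Finset.mul_sum, ← Finset.mul_sum] at hlt
  linarith [hxmax _ hm, hymax _ hm]

/-- A sum of jointly continuous functions on the quadrant passes to the limit along sequences. -/
theorem tendsto_sum_of_continuousOn_quadrant {ι : Type*} [Fintype ι] {U : ι → ℝ → ℝ → ℝ}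
    (hU : ∀ j, ContinuousOn (fun p : ℝ × ℝ => U j p.1 p.2) (Ici 0 ×ˢ Ici 0))
    {a b : ℕ → ι → ℝ} {x y : ι → ℝ} (ha : ∀ l j, 0 ≤ a l j) (hb : ∀ l j, 0 ≤ b l j)
    (hx : ∀ j, 0 ≤ x j) (hy : ∀ j, 0 ≤ y j)
    (hax : Tendsto a atTop (nhds x)) (hby : Tendsto b atTop (nhds y)) :
    Tendsto (fun l => ∑ j, U j (a l j) (b l j)) atTop (nhds (∑ j, U j (x j) (y j))) := by
  refine tendsto_finsetSum _ fun j _ => ?_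
  have h : Tendsto (fun l => (a l j, b l j)) atTop (nhds (x j, y j)) :=
    (tendsto_pi_nhds.1 hax j).prodMk_nhds (tendsto_pi_nhds.1 hby j)
  exact (hU j (x j, y j) ⟨hx j, hy j⟩).tendsto.comp
    (tendsto_nhdsWithin_iff.2 ⟨h, Eventually.of_forall fun l => ⟨ha l j, hb l j⟩⟩)

/-- continuity of the utility-maximizing rate allocation in the
queue state, in every coordinate with positive limiting queue length. -/
theorem utility_maximizer_continuous_on_positive_coords
    (J : ℕ) (hJ : 1 ≤ J) (U : Fin J → ℝ → ℝ → ℝ)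
    (R : Set (Fin J → ℝ)) (hRsub : R ⊆ {c | ∀ j, 0 ≤ c j})
    (hRcomp : IsCompact R) (hRconv : Convex ℝ R)
    (hUcont : ∀ j, ContinuousOn (fun p : ℝ × ℝ => U j p.1 p.2) (Ici 0 ×ˢ Ici 0))
    (hU1 : ∀ j, ∀ c : ℝ, 0 ≤ c → U j 0 c = 0)
    (hU2mono : ∀ j, ∀ q : ℝ, 0 < q → StrictMonoOn (U j q) (Ici (0 : ℝ)))
    (hU2conc : ∀ j, ∀ q : ℝ, 0 < q → StrictConcaveOn ℝ (Ici (0 : ℝ)) (U j q))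
    (ql : ℕ → Fin J → ℝ) (hql : ∀ l j, 0 ≤ ql l j)
    (q : Fin J → ℝ) (hq : ∀ j, 0 ≤ q j)
    (hqconv : Tendsto ql atTop (nhds q))
    (Λl : ℕ → Fin J → ℝ) (hΛl : ∀ l, Λl l ∈ R)
    (hΛlmax : ∀ l, ∀ c ∈ R, ∑ j, U j (ql l j) (c j) ≤ ∑ j, U j (ql l j) (Λl l j))
    (Λ : Fin J → ℝ) (hΛ : Λ ∈ R)
    (hΛmax : ∀ c ∈ R, ∑ j, U j (q j) (c j) ≤ ∑ j, U j (q j) (Λ j)) :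
    ∀ j, 0 < q j → Tendsto (fun l => Λl l j) atTop (nhds (Λ j)) := by
  intro i hi
  refine tendsto_of_subseq_tendsto fun ns hns => ?_
  obtain ⟨M, hM, φ, hφ, hlim⟩ := hRcomp.tendsto_subseq fun n => hΛl (ns n)
  refine ⟨φ, ?_⟩
  have hqsub : Tendsto (fun n => ql (ns (φ n))) atTop (nhds q) :=
    hqconv.comp (hns.comp hφ.tendsto_atTop)
  have hMmax : ∀ c ∈ R, ∑ j, U j (q j) (c j) ≤ ∑ j, U j (q j) (M j) := fun c hc =>
    le_of_tendsto_of_tendsto'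
      (tendsto_sum_of_continuousOn_quadrant hUcont (fun n => hql _) (fun _ => hRsub hc) hq
        (hRsub hc) hqsub tendsto_const_nhds)
      (tendsto_sum_of_continuousOn_quadrant hUcont (fun n => hql _) (fun n => hRsub (hΛl _)) hq
        (hRsub hM) hqsub hlim)
      fun n => hΛlmax _ c hc
  have hf : ∀ j, StrictConcaveOn ℝ (Ici (0 : ℝ)) (U j (q j)) ∨
      ∀ c, 0 ≤ c → U j (q j) c = 0 := fun j => by
    rcases (hq j).eq_or_lt with h | h
    · rw [← h]
      exact Or.inr (hU1 j)
    · exact Or.inl (hU2conc j _ h)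
  rw [← maximizers_eq_of_strictConcaveOn hRsub hRconv hf hM hΛ hMmax hΛmax (hU2conc i _ hi)]
  exact tendsto_pi_nhds.1 hlim i
end

section
/- Let J ≥ 1, let R ⊆ [0,∞)^J, let q ∈ (0,∞)^J, and assume for each j that c ↦ U_j(q_j,c) is differentiable, strictly increasing, and concave on [0,∞). Suppose ρ maximizes c ↦ Σ_{j=1}^J U_j(q_j,c_j) over c ∈ R, and that ρ lies in the relative interior of the sum-capacity facet of R, i.e., ρ ∈ R, ρ_j > 0 for all j, Σ_j ρ_j = C_U, and there exists δ > 0 such that every c ∈ [0,∞)^J with Σ_j c_j = C_U and Σ_j |c_j − ρ_j| < δ belongs to R. Then there exists θ > 0 such that (∂U_j/∂c)(q_j, ρ_j) = θ for every j ∈ {1,…,J} (the marginal utilities are equalized at the maximizer). -/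
open Set

/-- A concave, strictly increasing function has positive derivative at interior points of a
half-line. -/
lemma ConcaveOn.deriv_pos_of_strictMonoOn_Ici {f : ℝ → ℝ} {a x f' : ℝ}
    (hconc : ConcaveOn ℝ (Ici a) f) (hmono : StrictMonoOn f (Ici a)) (hx : a ≤ x)
    (hf : HasDerivAt f f' x) : 0 < f' := by
  have hx1 : x + 1 ∈ Ici a := by simp only [mem_Ici]; linarith
  have hlt : f x < f (x + 1) := hmono hx hx1 (by linarith)
  have hslope : slope f x (x + 1) ≤ f' :=
    hconc.slope_le_of_hasDerivAt hx hx1 (by linarith) hf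
  simp only [slope_def_field, add_sub_cancel_left, div_one] at hslope
  linarith

/-- First-order condition: if a separable sum `∑ k, f k (c k)` is locally maximal at `ρ` along the
line of direction `v`, its directional derivative vanishes. -/
lemma sum_mul_eq_zero_of_isLocalMax_along {ι : Type*} [Fintype ι] {f : ι → ℝ → ℝ}
    {f' ρ v : ι → ℝ} (hf : ∀ k, HasDerivAt (f k) (f' k) (ρ k))
    (hmax : IsLocalMax (fun t : ℝ => ∑ k, f k (ρ k + t * v k)) 0) :
    ∑ k, f' k * v k = 0 := by
  refine hmax.hasDerivAt_eq_zero (HasDerivAt.fun_sum fun k _ => ?_)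
  have hline : HasDerivAt (fun t : ℝ => ρ k + t * v k) (v k) 0 := by
    simpa using ((hasDerivAt_id (0 : ℝ)).mul_const (v k)).const_add (ρ k)
  exact HasDerivAt.comp (h₂ := f k) (0 : ℝ) (by simpa using hf k) hline

/-- at a maximizer lying in the relative interior of the
sum-capacity facet, all marginal utilities are equalized to a common θ > 0. -/
theorem marginal_utilities_equalized_at_sum_facet_maximizer
    (J : ℕ) (hJ : 1 ≤ J) (U dU : Fin J → ℝ → ℝ → ℝ)
    (R : Set (Fin J → ℝ)) (hRsub : R ⊆ {c | ∀ j, 0 ≤ c j})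
    (q : Fin J → ℝ) (hq : ∀ j, 0 < q j)
    (hderiv : ∀ j, ∀ c : ℝ, 0 ≤ c →
      HasDerivWithinAt (U j (q j)) (dU j (q j) c) (Ici 0) c)
    (hmono : ∀ j, StrictMonoOn (U j (q j)) (Ici (0 : ℝ)))
    (hconc : ∀ j, ConcaveOn ℝ (Ici (0 : ℝ)) (U j (q j)))
    (C_U : ℝ) (hCU : 0 < C_U)
    (ρ : Fin J → ℝ) (hρR : ρ ∈ R) (hρpos : ∀ j, 0 < ρ j)
    (hρsum : ∑ j, ρ j = C_U)
    (hfacet : ∃ δ > 0, ∀ c : Fin J → ℝ, (∀ j, 0 ≤ c j) → ∑ j, c j = C_U →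
      ∑ j, |c j - ρ j| < δ → c ∈ R)
    (hmax : ∀ c ∈ R, ∑ j, U j (q j) (c j) ≤ ∑ j, U j (q j) (ρ j)) :
    ∃ θ > 0, ∀ j, dU j (q j) (ρ j) = θ := by
  obtain ⟨δ, hδ, hfacet⟩ := hfacet
  have hd : ∀ j, HasDerivAt (U j (q j)) (dU j (q j) (ρ j)) (ρ j) := fun j =>
    (hderiv j (ρ j) (hρpos j).le).hasDerivAt (Ici_mem_nhds (hρpos j))
  have heq : ∀ i j, dU i (q i) (ρ i) = dU j (q j) (ρ j) := by
    intro i j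
    let v : Fin J → ℝ := Pi.single i 1 - Pi.single j 1
    have hv : ∑ k, v k = 0 := by simp [v, Finset.sum_sub_distrib]
    have hpos : ∀ᶠ t : ℝ in nhds 0, ∀ k, 0 < ρ k + t * v k := by
      refine Filter.eventually_all.2 fun k => ?_
      have hcont : Continuous fun t : ℝ => ρ k + t * v k := by fun_prop
      exact hcont.continuousAt.eventually_const_lt (by simpa using hρpos k)
    have hnear : ∀ᶠ t : ℝ in nhds 0, ∑ k, |ρ k + t * v k - ρ k| < δ := by
      have hcont : Continuous fun t : ℝ => ∑ k, |ρ k + t * v k - ρ k| := by fun_prop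
      exact hcont.continuousAt.eventually_lt_const (by simpa using hδ)
    have hlocal : IsLocalMax (fun t : ℝ => ∑ k, U k (q k) (ρ k + t * v k)) 0 := by
      filter_upwards [hpos, hnear] with t htpos htnear
      have hsum : ∑ k, (ρ k + t * v k) = C_U := by
        rw [Finset.sum_add_distrib, ← Finset.mul_sum, hv, hρsum, mul_zero, add_zero]
      simpa using hmax _ (hfacet _ (fun k => (htpos k).le) hsum htnear)
    have hzero := sum_mul_eq_zero_of_isLocalMax_along hd hlocal
    simp only [v, Pi.sub_apply, Pi.single_apply, mul_sub, Finset.sum_sub_distrib, mul_ite,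
      mul_one, mul_zero, Finset.sum_ite_eq', Finset.mem_univ, if_true] at hzero
    linarith
  let i₀ : Fin J := ⟨0, hJ⟩
  exact ⟨dU i₀ (q i₀) (ρ i₀),
    (hconc i₀).deriv_pos_of_strictMonoOn_Ici (hmono i₀) (hρpos i₀).le (hd i₀),
    fun j => heq j i₀⟩
end

section
/- Assume (U1)–(U3) and the definitions of C_j, V and CM(w,ρ). Let R ⊆ [0,∞)^J, let q ∈ (0,∞)^J, and set w := Σ_{j=1}^J q_j/μ_j. Suppose ρ maximizes c ↦ Σ_{j=1}^J U_j(q_j,c_j) over c ∈ R, and that ρ lies in the relative interior of the sum-capacity facet of R, i.e., ρ ∈ R, ρ_j > 0 for all j, Σ_j ρ_j = C_U, and there exists δ > 0 such that every c ∈ [0,∞)^J with Σ_j c_j = C_U and Σ_j |c_j − ρ_j| < δ belongs to R. Then q is the unique minimizer of the cost minimization problem CM(w,ρ): it minimizes V(q′,ρ) over all q′ ∈ [0,∞)^J with Σ_{j=1}^J q′_j/μ_j ≥ w, and it is the only such minimizer. -/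
open Set

open Filter Topology

/-- A function that is strictly increasing on `[0, ∞)` has its integral over an interval strictly
above the tangent-type lower bound given by its value at one endpoint. -/
lemma StrictMonoOn.mul_sub_lt_integral_sub {f : ℝ → ℝ} (hf : StrictMonoOn f (Ici 0)) {a b : ℝ}
    (ha : 0 ≤ a) (hb : 0 ≤ b) (hab : b ≠ a) :
    f a * (b - a) < (∫ u in (0 : ℝ)..b, f u) - ∫ u in (0 : ℝ)..a, f u := by
  have hint : ∀ x y : ℝ, 0 ≤ x → 0 ≤ y → IntervalIntegrable f MeasureTheory.volume x y := by
    intro x y hx hy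
    refine (hf.monotoneOn.mono fun u hu => ?_).intervalIntegrable
    exact (le_min hx hy).trans hu.1
  rw [intervalIntegral.integral_interval_sub_left (hint 0 b le_rfl hb) (hint 0 a le_rfl ha)]
  rcases hab.lt_or_gt with h | h
  · have hpos : 0 < ∫ u in b..a, (f a - f u) :=
      intervalIntegral.intervalIntegral_pos_of_pos_on
        (intervalIntegrable_const.sub (hint b a hb ha))
        (fun u hu => sub_pos.2 (hf (hb.trans hu.1.le) ha hu.2)) h
    rw [intervalIntegral.integral_sub intervalIntegrable_const (hint b a hb ha),
      intervalIntegral.integral_const, smul_eq_mul] at hpos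
    rw [intervalIntegral.integral_symm b a]
    linarith
  · have hpos : 0 < ∫ u in a..b, (f u - f a) :=
      intervalIntegral.intervalIntegral_pos_of_pos_on
        ((hint a b ha hb).sub intervalIntegrable_const)
        (fun u hu => sub_pos.2 (hf ha (ha.trans hu.1.le) hu.1)) h
    rw [intervalIntegral.integral_sub (hint a b ha hb) intervalIntegrable_const,
      intervalIntegral.integral_const, smul_eq_mul] at hpos
    linarith

/-- At a maximizer of a separable function in the relative interior of a facet
`∑ j, c j = C`, all partial derivatives coincide. -/
lemma deriv_eq_of_forall_sum_le_of_mem_facet {ι : Type*} [Fintype ι] {g : ι → ℝ → ℝ}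
    {g' ρ : ι → ℝ} (hg : ∀ j, HasDerivAt (g j) (g' j) (ρ j)) {R : Set (ι → ℝ)} {C : ℝ}
    (hρpos : ∀ j, 0 < ρ j) (hρsum : ∑ j, ρ j = C)
    (hfacet : ∃ δ > 0, ∀ c : ι → ℝ, (∀ j, 0 ≤ c j) → ∑ j, c j = C →
      ∑ j, |c j - ρ j| < δ → c ∈ R)
    (hmax : ∀ c ∈ R, ∑ j, g j (c j) ≤ ∑ j, g j (ρ j)) (i k : ι) : g' i = g' k := by
  classical
  obtain ⟨δ, hδ, hR⟩ := hfacet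
  set d : ι → ℝ := Pi.single i 1 - Pi.single k 1 with hd
  have hdsum : ∑ j, d j = 0 := by simp [hd]
  have hderiv : HasDerivAt (fun t : ℝ => ∑ j, g j (ρ j + t * d j)) (∑ j, g' j * d j) 0 := by
    refine HasDerivAt.fun_sum fun j _ => ?_
    have h1 : HasDerivAt (fun t : ℝ => ρ j + t * d j) (d j) 0 := by
      simpa using ((hasDerivAt_id (0 : ℝ)).mul_const (d j)).const_add (ρ j)
    have h2 : HasDerivAt (g j) (g' j) (ρ j + 0 * d j) := by simpa using hg j
    exact h2.comp (0 : ℝ) h1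
  have hnonneg : ∀ᶠ t : ℝ in 𝓝 0, ∀ j, 0 < ρ j + t * d j := by
    refine eventually_all.2 fun j => ?_
    have hc : Continuous fun t : ℝ => ρ j + t * d j := by fun_prop
    exact hc.continuousAt.eventually (lt_mem_nhds (by simpa using hρpos j))
  have hnear : ∀ᶠ t : ℝ in 𝓝 0, ∑ j, |ρ j + t * d j - ρ j| < δ := by
    have hc : Continuous fun t : ℝ => ∑ j, |ρ j + t * d j - ρ j| := by fun_prop
    exact hc.continuousAt.eventually (gt_mem_nhds (by simpa using hδ))
  have hloc : IsLocalMax (fun t : ℝ => ∑ j, g j (ρ j + t * d j)) 0 := by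
    filter_upwards [hnonneg, hnear] with t ht1 ht2
    have := hmax (fun j => ρ j + t * d j) (hR _ (fun j => (ht1 j).le)
      (by rw [Finset.sum_add_distrib, ← Finset.mul_sum, hdsum, hρsum, mul_zero, add_zero]) ht2)
    simpa using this
  have h0 := hloc.hasDerivAt_eq_zero hderiv
  simp only [hd, Pi.sub_apply, mul_sub, Finset.sum_sub_distrib, Pi.single_apply, mul_ite, mul_one,
    mul_zero, Finset.sum_ite_eq', Finset.mem_univ, if_true] at h0
  exact sub_eq_zero.1 h0

/-- if ρ maximizes utility at queue state q (with ρ in the relative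
interior of the sum-capacity facet), then q is the unique optimal solution of
the dual cost minimization problem CM(w,ρ) with w = Σ q_j/μ_j. -/
theorem utility_maximizer_gives_unique_cost_minimizer
    (J : ℕ) (hJ : 1 ≤ J) (μ : Fin J → ℝ) (hμ : ∀ j, 0 < μ j)
    (U dU : Fin J → ℝ → ℝ → ℝ)
    (hC2 : ∀ j, ContDiffOn ℝ 2 (fun p : ℝ × ℝ => U j p.1 p.2) (Ici 0 ×ˢ Ici 0))
    (hderiv : ∀ j, ∀ qv c : ℝ, 0 ≤ qv → 0 ≤ c →
      HasDerivWithinAt (U j qv) (dU j qv c) (Ici 0) c)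
    (hU1 : ∀ j, ∀ c : ℝ, 0 ≤ c → U j 0 c = 0)
    (hU2mono : ∀ j, ∀ qv : ℝ, 0 < qv → StrictMonoOn (U j qv) (Ici (0 : ℝ)))
    (hU2conc : ∀ j, ∀ qv : ℝ, 0 < qv → StrictConcaveOn ℝ (Ici (0 : ℝ)) (U j qv))
    (hU3 : ∀ j, ∀ c : ℝ, 0 < c → StrictMonoOn (fun qv => dU j qv c) (Ici (0 : ℝ)))
    (V : (Fin J → ℝ) → (Fin J → ℝ) → ℝ)
    (hV : ∀ q c : Fin J → ℝ, V q c = ∑ j, (1 / μ j) * ∫ u in (0 : ℝ)..(q j), dU j u (c j))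
    (R : Set (Fin J → ℝ)) (hRsub : R ⊆ {c | ∀ j, 0 ≤ c j})
    (q : Fin J → ℝ) (hq : ∀ j, 0 < q j)
    (w : ℝ) (hw : w = ∑ j, q j / μ j)
    (C_U : ℝ) (hCU : 0 < C_U)
    (ρ : Fin J → ℝ) (hρR : ρ ∈ R) (hρpos : ∀ j, 0 < ρ j)
    (hρsum : ∑ j, ρ j = C_U)
    (hfacet : ∃ δ > 0, ∀ c : Fin J → ℝ, (∀ j, 0 ≤ c j) → ∑ j, c j = C_U →
      ∑ j, |c j - ρ j| < δ → c ∈ R)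
    (hmax : ∀ c ∈ R, ∑ j, U j (q j) (c j) ≤ ∑ j, U j (q j) (ρ j)) :
    (∀ q' : Fin J → ℝ, (∀ j, 0 ≤ q' j) → w ≤ ∑ j, q' j / μ j → V q ρ ≤ V q' ρ) ∧
    (∀ q' : Fin J → ℝ, (∀ j, 0 ≤ q' j) → w ≤ ∑ j, q' j / μ j →
      V q' ρ = V q ρ → q' = q) := by
  have hdU0 : ∀ j, dU j 0 (ρ j) = 0 := fun j => by
    have h : HasDerivWithinAt (U j 0) 0 (Ici 0) (ρ j) :=
      (hasDerivWithinAt_const (ρ j) (Ici 0) (0 : ℝ)).congr (fun c hc => hU1 j c hc)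
        (hU1 j _ (hρpos j).le)
    exact (uniqueDiffOn_Ici (0 : ℝ) _ (hρpos j).le).eq_deriv _ (hderiv j 0 _ le_rfl (hρpos j).le) h
  have heq := deriv_eq_of_forall_sum_le_of_mem_facet
    (fun j => (hderiv j (q j) (ρ j) (hq j).le (hρpos j).le).hasDerivAt (Ici_mem_nhds (hρpos j)))
    hρpos hρsum hfacet hmax
  let j₀ : Fin J := ⟨0, hJ⟩
  set l : ℝ := dU j₀ (q j₀) (ρ j₀) with hl
  have hlpos : 0 < l := by
    rw [hl, ← hdU0 j₀]
    exact hU3 j₀ _ (hρpos j₀) self_mem_Ici (hq j₀).le (hq j₀)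
  have hlt : ∀ q' : Fin J → ℝ, (∀ j, 0 ≤ q' j) → w ≤ ∑ j, q' j / μ j → q' ≠ q →
      V q ρ < V q' ρ := by
    intro q' hq' hw' hne
    have hstrict : ∀ j, q' j ≠ q j → l * (q' j / μ j - q j / μ j) <
        (1 / μ j) * (∫ u in (0 : ℝ)..(q' j), dU j u (ρ j)) -
          (1 / μ j) * ∫ u in (0 : ℝ)..(q j), dU j u (ρ j) := by
      intro j hj
      have h := mul_lt_mul_of_pos_left
        ((hU3 j _ (hρpos j)).mul_sub_lt_integral_sub (hq j).le (hq' j) hj)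
        (one_div_pos.2 (hμ j))
      rw [heq j j₀, mul_sub (1 / μ j)] at h
      refine lt_of_eq_of_lt ?_ h
      ring
    obtain ⟨i, hi⟩ := Function.ne_iff.1 hne
    have hsum : ∑ j, l * (q' j / μ j - q j / μ j) < V q' ρ - V q ρ := by
      rw [hV, hV, ← Finset.sum_sub_distrib]
      refine Finset.sum_lt_sum (fun j _ => ?_) ⟨i, Finset.mem_univ i, hstrict i hi⟩
      by_cases hj : q' j = q j
      · simp [hj]
      · exact (hstrict j hj).le
    rw [← Finset.mul_sum, Finset.sum_sub_distrib, ← hw] at hsum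
    have := mul_nonneg hlpos.le (sub_nonneg.2 hw')
    linarith
  refine ⟨fun q' hq' hw' => ?_, fun q' hq' hw' hVeq => ?_⟩
  · by_cases h : q' = q
    · rw [h]
    · exact (hlt q' hq' hw' h).le
  · by_contra h
    exact (hlt q' hq' hw' h).ne' hVeq
end

section
/- Assume (U1)–(U4) and the definitions of C_j, V and CM(w,ρ). Let ρ ∈ (0,∞)^J, let w > 0, and let q* be a minimizer of CM(w,ρ), i.e., q* minimizes V(q,ρ) over all q ∈ [0,∞)^J with Σ_{j=1}^J q_j/μ_j ≥ w. Then q*_j > 0 for every j ∈ {1,…,J}: the optimal solution of the cost minimization problem with positive workload has all components strictly positive. -/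
open Set Filter

/-- The tangent-line bound for the integral of a monotone function, valid for either order of the
end points. -/
lemma integral_sub_integral_le_of_monotoneOn {f : ℝ → ℝ} (hf : MonotoneOn f (Ici 0))
    {x y : ℝ} (hx : 0 ≤ x) (hy : 0 ≤ y) :
    (∫ u in (0 : ℝ)..y, f u) - ∫ u in (0 : ℝ)..x, f u ≤ (y - x) * f y := by
  have hint : ∀ {a b : ℝ}, 0 ≤ a → 0 ≤ b → IntervalIntegrable f MeasureTheory.volume a b := by
    intro a b ha hb
    refine (hf.mono fun t ht => ?_).intervalIntegrable
    exact (le_min ha hb).trans ht.1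
  rw [intervalIntegral.integral_interval_sub_left (hint le_rfl hy) (hint le_rfl hx)]
  rcases le_total x y with h | h
  · have := intervalIntegral.integral_mono_on h (hint hx hy)
      (intervalIntegrable_const (c := f y))
      fun t ht => hf (hx.trans ht.1) hy ht.2
    simpa using this
  · have := intervalIntegral.integral_mono_on h (intervalIntegrable_const (c := f y))
      (hint hy hx) fun t ht => hf hy (hy.trans ht.1) ht.1
    rw [intervalIntegral.integral_symm]
    simp only [intervalIntegral.integral_const, smul_eq_mul] at this
    linarith

/-- If `U` is continuous, vanishes at `q = 0` and is concave in `c`, then its derivative in `c` is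
eventually below any positive bound as `q` decreases to `0`. -/
lemma eventually_deriv_lt_of_concaveOn {U dU : ℝ → ℝ → ℝ}
    (hcont : ContinuousOn (fun p : ℝ × ℝ => U p.1 p.2) (Ici 0 ×ˢ Ici 0))
    (hderiv : ∀ q c : ℝ, 0 ≤ q → 0 ≤ c → HasDerivWithinAt (U q) (dU q c) (Ici 0) c)
    (hzero : ∀ c : ℝ, 0 ≤ c → U 0 c = 0)
    (hconc : ∀ q : ℝ, 0 < q → ConcaveOn ℝ (Ici (0 : ℝ)) (U q))
    {c a : ℝ} (hc : 0 < c) (ha : 0 < a) :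
    ∀ᶠ q in nhdsWithin 0 (Ioi 0), dU q c < a := by
  have hsection : ∀ d : ℝ, 0 ≤ d →
      Tendsto (fun q => U q d) (nhdsWithin 0 (Ioi 0)) (nhds 0) := by
    intro d hd
    have h : ContinuousOn (fun q : ℝ => U q d) (Ici 0) :=
      hcont.comp (f := fun q : ℝ => (q, d)) (by fun_prop) fun q hq => ⟨hq, hd⟩
    have h0 := (h 0 self_mem_Ici).mono Ioi_subset_Ici_self
    simpa only [ContinuousWithinAt, hzero d hd] using h0
  have hslope : Tendsto (fun q => (U q c - U q 0) / c) (nhdsWithin 0 (Ioi 0)) (nhds 0) := by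
    simpa using ((hsection c hc.le).sub (hsection 0 le_rfl)).div_const c
  filter_upwards [hslope.eventually_lt_const ha, self_mem_nhdsWithin] with q hq hq0
  refine lt_of_le_of_lt ?_ hq
  have hd : HasDerivAt (U q) (dU q c) c :=
    (hderiv q c (le_of_lt hq0) hc.le).hasDerivAt (Ici_mem_nhds hc)
  have h := (hconc q hq0).le_slope_of_hasDerivAt self_mem_Ici hc.le hc hd
  simpa [slope_def_field] using h

/-- every optimal solution of the cost minimization problem
CM(w,ρ) with w > 0 and ρ ∈ (0,∞)^J has all components strictly positive. -/
theorem cost_minimizer_positive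
    (J : ℕ) (hJ : 1 ≤ J) (μ : Fin J → ℝ) (hμ : ∀ j, 0 < μ j)
    (U dU : Fin J → ℝ → ℝ → ℝ)
    (hC2 : ∀ j, ContDiffOn ℝ 2 (fun p : ℝ × ℝ => U j p.1 p.2) (Ici 0 ×ˢ Ici 0))
    (hderiv : ∀ j, ∀ qv c : ℝ, 0 ≤ qv → 0 ≤ c →
      HasDerivWithinAt (U j qv) (dU j qv c) (Ici 0) c)
    (hU1 : ∀ j, ∀ c : ℝ, 0 ≤ c → U j 0 c = 0)
    (hU2mono : ∀ j, ∀ qv : ℝ, 0 < qv → StrictMonoOn (U j qv) (Ici (0 : ℝ)))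
    (hU2conc : ∀ j, ∀ qv : ℝ, 0 < qv → StrictConcaveOn ℝ (Ici (0 : ℝ)) (U j qv))
    (hU3 : ∀ j, ∀ c : ℝ, 0 < c → StrictMonoOn (fun qv => dU j qv c) (Ici (0 : ℝ)))
    (hU4zero : ∀ j, ∀ c : ℝ, 0 < c → dU j 0 c = 0)
    (hU4infty : ∀ j, ∀ c : ℝ, 0 < c → Tendsto (fun qv => dU j qv c) atTop atTop)
    (V : (Fin J → ℝ) → (Fin J → ℝ) → ℝ)
    (hV : ∀ q c : Fin J → ℝ, V q c = ∑ j, (1 / μ j) * ∫ u in (0 : ℝ)..(q j), dU j u (c j))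
    (ρ : Fin J → ℝ) (hρpos : ∀ j, 0 < ρ j)
    (w : ℝ) (hw : 0 < w)
    (qstar : Fin J → ℝ) (hqstar_nonneg : ∀ j, 0 ≤ qstar j)
    (hqstar_feas : w ≤ ∑ j, qstar j / μ j)
    (hqstar_min : ∀ q : Fin J → ℝ, (∀ j, 0 ≤ q j) → w ≤ ∑ j, q j / μ j →
      V qstar ρ ≤ V q ρ) :
    ∀ j, 0 < qstar j := by
  by_contra! hcon
  obtain ⟨i, hi⟩ := hcon
  have hi0 : qstar i = 0 := le_antisymm hi (hqstar_nonneg i)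
  obtain ⟨k, hk⟩ : ∃ k, 0 < qstar k := by
    by_contra! h
    have : ∑ j, qstar j / μ j ≤ 0 :=
      Finset.sum_nonpos fun j _ => div_nonpos_of_nonpos_of_nonneg (h j) (hμ j).le
    linarith
  have hik : k ≠ i := by
    rintro rfl
    linarith
  have hmono : ∀ j, MonotoneOn (fun u => dU j u (ρ j)) (Ici 0) :=
    fun j => (hU3 j _ (hρpos j)).monotoneOn
  set a := dU k (qstar k / 2) (ρ k) with ha_def
  have ha : 0 < a := by
    have := hU3 k _ (hρpos k) self_mem_Ici (half_pos hk).le (half_pos hk)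
    simpa only [hU4zero k _ (hρpos k)] using this
  have hmarg : ∀ᶠ x in nhdsWithin 0 (Ioi 0), dU i x (ρ i) < a :=
    eventually_deriv_lt_of_concaveOn (hC2 i).continuousOn (hderiv i) (hU1 i)
      (fun q hq => (hU2conc i q hq).concaveOn) (hρpos i) ha
  have hr : 0 < μ i * (qstar k / 2 / μ k) :=
    mul_pos (hμ i) (div_pos (half_pos hk) (hμ k))
  obtain ⟨x, hxa, hx0, hxr⟩ := (hmarg.and (Ioo_mem_nhdsGT hr)).exists
  obtain ⟨ε, rfl⟩ : ∃ ε, x = μ i * ε := ⟨x / μ i, by field_simp [(hμ i).ne']⟩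
  have hε : 0 < ε := pos_of_mul_pos_right hx0 (hμ i).le
  have hεk : μ k * ε ≤ qstar k / 2 := by
    have := (lt_of_mul_lt_mul_left hxr (hμ i).le).le
    rwa [le_div_iff₀ (hμ k), mul_comm] at this
  set q : Fin J → ℝ := fun j =>
    qstar j + (if j = i then μ j * ε else 0) - (if j = k then μ j * ε else 0) with hq_def
  have hqi : q i = μ i * ε := by simp [hq_def, hi0, hik.symm]
  have hqk : q k = qstar k - μ k * ε := by simp [hq_def, hik]
  have hqne : ∀ j, j ≠ i → j ≠ k → q j = qstar j := fun j h h' => by simp [hq_def, h, h']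
  have hq0 : ∀ j, 0 ≤ q j := by
    intro j
    by_cases h : j = i
    · subst h
      exact hqi ▸ hx0.le
    by_cases h' : j = k
    · subst h'
      rw [hqk]
      linarith
    · exact hqne j h h' ▸ hqstar_nonneg j
  have hqw : w ≤ ∑ j, q j / μ j := by
    have hterm : ∀ j, q j / μ j =
        qstar j / μ j + (if j = i then ε else 0) - (if j = k then ε else 0) := by
      intro j
      have := (hμ j).ne'
      simp only [hq_def]
      split_ifs <;> field_simp <;> ring
    simpa [hterm, Finset.sum_add_distrib, Finset.sum_sub_distrib] using hqstar_feas
  have hle : V q ρ - V qstar ρ ≤ ∑ j,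
      ((if j = i then ε * dU i (μ i * ε) (ρ i) else 0) - (if j = k then ε * a else 0)) := by
    rw [hV, hV, ← Finset.sum_sub_distrib]
    refine Finset.sum_le_sum fun j _ => ?_
    have hbound := integral_sub_integral_le_of_monotoneOn (hmono j) (hqstar_nonneg j) (hq0 j)
    rw [← mul_sub, one_div, inv_mul_le_iff₀ (hμ j)]
    refine hbound.trans ?_
    by_cases h : j = i
    · subst h
      simp [hqi, hi0, hik.symm, mul_assoc]
    by_cases h' : j = k
    · subst h'
      have hak : a ≤ dU j (q j) (ρ j) :=
        hmono j (half_pos hk).le (hq0 j) (by rw [hqk]; linarith)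
      have := mul_le_mul_of_nonneg_left hak (mul_pos (hμ j) hε).le
      simp only [h, if_true, if_false]
      calc (q j - qstar j) * dU j (q j) (ρ j)
          = -(μ j * ε * dU j (q j) (ρ j)) := by
            nth_rewrite 1 [hqk]
            ring
        _ ≤ μ j * (0 - ε * a) := by linarith
    · simp [hqne j h h', h, h']
  have hsum : ∑ j, ((if j = i then ε * dU i (μ i * ε) (ρ i) else 0) -
      (if j = k then ε * a else 0)) = ε * dU i (μ i * ε) (ρ i) - ε * a := by
    simp [Finset.sum_sub_distrib]
  have hlt := mul_lt_mul_of_pos_left hxa hε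
  linarith [hqstar_min q hq0 hqw]
end

section
/- Assume (U1)–(U4) and the definitions of C_j, V and CM(w,ρ). Let R ⊆ {c ∈ [0,∞)^J : Σ_{j=1}^J c_j ≤ C_U} and let ρ ∈ R with ρ_j > 0 for all j and Σ_{j=1}^J ρ_j = C_U. Let w > 0 and let q* be a minimizer of CM(w,ρ). Then q*_j > 0 for every j, and ρ maximizes c ↦ Σ_{j=1}^J U_j(q*_j,c_j) over c ∈ R: the optimal cost-minimizing queue state makes ρ an optimal solution of the utility maximization problem. -/
open Set Filter

/-- The change of a separable sum under an update of two coordinates. -/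
theorem sum_apply_update_update {ι : Type*} [Fintype ι] [DecidableEq ι] (G : ι → ℝ → ℝ)
    (q : ι → ℝ) {j k : ι} (hjk : j ≠ k) (x y : ℝ) :
    ∑ i, G i (Function.update (Function.update q j x) k y i) =
      ∑ i, G i (q i) + (G j x - G j (q j)) + (G k y - G k (q k)) := by
  have h : ∑ i, (G i (Function.update (Function.update q j x) k y i) - G i (q i)) =
      (G j x - G j (q j)) + (G k y - G k (q k)) := by
    rw [Finset.sum_eq_add j k hjk]
    · simp [Function.update_of_ne hjk]
    · rintro i - ⟨hij, hik⟩
      simp [hij, hik]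
    · simp
    · simp
  rw [Finset.sum_sub_distrib] at h
  linarith

/-- The partial derivative in the second variable of a `C²` function on the closed quadrant is
continuous in the first variable. -/
theorem continuousOn_partial_snd {U dU : ℝ → ℝ → ℝ}
    (hC2 : ContDiffOn ℝ 2 (fun p : ℝ × ℝ => U p.1 p.2) (Ici 0 ×ˢ Ici 0))
    (hderiv : ∀ q c : ℝ, 0 ≤ q → 0 ≤ c → HasDerivWithinAt (U q) (dU q c) (Ici 0) c)
    {c : ℝ} (hc : 0 ≤ c) : ContinuousOn (fun q => dU q c) (Ici 0) := by
  have hS : UniqueDiffOn ℝ (Ici (0 : ℝ) ×ˢ Ici (0 : ℝ)) :=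
    (uniqueDiffOn_Ici 0).prod (uniqueDiffOn_Ici 0)
  have hf := hC2.continuousOn_fderivWithin hS (by norm_num)
  have hcont : ContinuousOn (fun q : ℝ => fderivWithin ℝ (fun p : ℝ × ℝ => U p.1 p.2)
      (Ici 0 ×ˢ Ici 0) (q, c) (0, 1)) (Ici 0) :=
    (hf.comp (f := fun q : ℝ => (q, c)) (by fun_prop) (fun q hq => ⟨hq, hc⟩)).clm_apply continuousOn_const
  refine hcont.congr fun q hq => ?_
  have hd := ((hC2.differentiableOn (by norm_num)) (q, c) ⟨hq, hc⟩).hasFDerivWithinAt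
  have hline : HasDerivWithinAt (fun x : ℝ => (q, x)) (0, 1) (Ici 0) c :=
    (hasDerivWithinAt_const c _ q).prodMk (hasDerivWithinAt_id c _)
  have hcomp := hd.comp_hasDerivWithinAt c hline (fun x hx => ⟨hq, hx⟩)
  exact (uniqueDiffOn_Ici (0 : ℝ) c hc).eq_deriv _ (hderiv q c hq hc) hcomp

/-- A concave function lies below its tangent line. -/
theorem ConcaveOn.le_tangent {s : Set ℝ} {f : ℝ → ℝ} (hf : ConcaveOn ℝ s f) {x y f' : ℝ}
    (hx : x ∈ s) (hy : y ∈ s) (hd : HasDerivAt f f' x) : f y ≤ f x + f' * (y - x) := by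
  rcases lt_trichotomy x y with h | h | h
  · have := hf.slope_le_of_hasDerivAt hx hy h hd
    rw [slope_def_field, div_le_iff₀ (by linarith)] at this
    linarith
  · simp [h]
  · have := hf.le_slope_of_hasDerivAt hy hx h hd
    rw [slope_def_field, le_div_iff₀ (by linarith)] at this
    linarith

/-- First-order condition for a minimizer of a separable integral cost under a linear constraint:
moving mass from a positive coordinate `k` to another coordinate `j` cannot reduce the cost. -/
theorem marginal_le_of_isMin {ι : Type*} [Fintype ι] {μ : ι → ℝ} (hμ : ∀ j, 0 < μ j)
    {g : ι → ℝ → ℝ} (hmono : ∀ j, MonotoneOn (g j) (Ici 0))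
    (hcont : ∀ j, ContinuousOn (g j) (Ici 0)) {w : ℝ} {q : ι → ℝ} (hq : ∀ j, 0 ≤ q j)
    (hfeas : w ≤ ∑ j, q j / μ j)
    (hmin : ∀ p : ι → ℝ, (∀ j, 0 ≤ p j) → w ≤ ∑ j, p j / μ j →
      ∑ j, (1 / μ j) * ∫ u in (0 : ℝ)..(q j), g j u ≤
        ∑ j, (1 / μ j) * ∫ u in (0 : ℝ)..(p j), g j u)
    {j k : ι} (hk : 0 < q k) : g k (q k) ≤ g j (q j) := by
  classical
  rcases eq_or_ne j k with rfl | hjk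
  · rfl
  have hint : ∀ i (a b : ℝ), 0 ≤ a → 0 ≤ b →
      IntervalIntegrable (g i) MeasureTheory.volume a b := fun i a b ha hb =>
    ((hcont i).mono fun x hx => le_trans (le_min ha hb) hx.1).intervalIntegrable
  have key : ∀ ε : ℝ, 0 < ε → μ k * ε < q k →
      g k (q k - μ k * ε) ≤ g j (q j + μ j * ε) := by
    intro ε hε hlt
    have hμj := hμ j
    have hμk := hμ k
    have hjε : 0 < μ j * ε := mul_pos hμj hε
    have hkε : 0 < μ k * ε := mul_pos hμk hε
    have hqj := hq j
    have hle := hmin (Function.update (Function.update q j (q j + μ j * ε)) k (q k - μ k * ε))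
      (by
        intro i
        rcases eq_or_ne i k with rfl | hik
        · simpa using hlt.le
        rcases eq_or_ne i j with rfl | hij
        · rw [Function.update_of_ne hik, Function.update_self]; linarith
        · simpa [hij, hik] using hq i)
      (by
        rw [sum_apply_update_update (fun i x => x / μ i) q hjk]
        have h1 : (q j + μ j * ε) / μ j - q j / μ j = ε := by field_simp; ring
        have h2 : (q k - μ k * ε) / μ k - q k / μ k = -ε := by field_simp; ring
        simp only [h1, h2]
        linarith)
    rw [sum_apply_update_update (fun i x => (1 / μ i) * ∫ u in (0 : ℝ)..x, g i u) q hjk] at hle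
    simp only [← mul_sub] at hle
    rw [intervalIntegral.integral_interval_sub_left (hint _ _ _ le_rfl (by linarith))
        (hint _ _ _ le_rfl hqj),
      ← neg_sub (∫ u in (0 : ℝ)..(q k), g k u),
      intervalIntegral.integral_interval_sub_left (hint _ _ _ le_rfl hk.le)
        (hint _ _ _ le_rfl (by linarith))] at hle
    have hupper : ∫ u in (q j)..(q j + μ j * ε), g j u ≤ μ j * ε * g j (q j + μ j * ε) := by
      have := intervalIntegral.integral_mono_on (f := g j) (g := fun _ => g j (q j + μ j * ε))
        (by linarith : q j ≤ q j + μ j * ε) (hint _ _ _ hqj (by linarith)) (by simp)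
        (fun x hx => hmono j (hqj.trans hx.1) (by simp only [mem_Ici]; linarith) hx.2)
      simpa using this
    have hlower : μ k * ε * g k (q k - μ k * ε) ≤ ∫ u in (q k - μ k * ε)..(q k), g k u := by
      have := intervalIntegral.integral_mono_on (f := fun _ => g k (q k - μ k * ε)) (g := g k)
        (by linarith : q k - μ k * ε ≤ q k) (by simp) (hint _ _ _ (by linarith) hk.le)
        (fun x hx => hmono k (by simp only [mem_Ici]; linarith)
          (by simp only [mem_Ici]; linarith [hx.1]) hx.1)
      simpa using this
    have hupper' := mul_le_mul_of_nonneg_left hupper (one_div_pos.2 hμj).le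
    have hlower' := mul_le_mul_of_nonneg_left hlower (one_div_pos.2 hμk).le
    have e1 : 1 / μ j * (μ j * ε * g j (q j + μ j * ε)) = ε * g j (q j + μ j * ε) := by
      field_simp
    have e2 : 1 / μ k * (μ k * ε * g k (q k - μ k * ε)) = ε * g k (q k - μ k * ε) := by
      field_simp
    refine le_of_mul_le_mul_left ?_ hε
    linarith
  have hsmall : ∀ᶠ ε in nhdsWithin (0 : ℝ) (Ioi 0), μ k * ε < q k := by
    have : Tendsto (fun ε : ℝ => μ k * ε) (nhdsWithin 0 (Ioi 0)) (nhds (μ k * 0)) :=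
      Tendsto.mono_left (Continuous.tendsto (by fun_prop) 0) nhdsWithin_le_nhds
    exact this.eventually_lt_const (by simpa using hk)
  have hpos : ∀ᶠ ε in nhdsWithin (0 : ℝ) (Ioi 0), 0 < ε := self_mem_nhdsWithin
  have limk : Tendsto (fun ε : ℝ => g k (q k - μ k * ε)) (nhdsWithin 0 (Ioi 0))
      (nhds (g k (q k))) := by
    refine (hcont k (q k) hk.le).tendsto.comp (tendsto_nhdsWithin_iff.2 ⟨?_, ?_⟩)
    · exact Tendsto.mono_left (Continuous.tendsto' (by fun_prop) 0 _ (by simp))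
        nhdsWithin_le_nhds
    · filter_upwards [hsmall] with ε h
      simp only [mem_Ici]; linarith
  have limj : Tendsto (fun ε : ℝ => g j (q j + μ j * ε)) (nhdsWithin 0 (Ioi 0))
      (nhds (g j (q j))) := by
    refine (hcont j (q j) (hq j)).tendsto.comp (tendsto_nhdsWithin_iff.2 ⟨?_, ?_⟩)
    · exact Tendsto.mono_left (Continuous.tendsto' (by fun_prop) 0 _ (by simp))
        nhdsWithin_le_nhds
    · filter_upwards [hpos] with ε h
      exact add_nonneg (hq j) (mul_pos (hμ j) h).le
  refine le_of_tendsto_of_tendsto limk limj ?_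
  filter_upwards [hsmall, hpos] with ε h1 h2
  exact key ε h2 h1

/-- the optimal solution q* of the cost minimization problem
CM(w,ρ) with w > 0 is strictly positive, and ρ (a point of the sum-capacity
facet) maximizes the utility c ↦ Σ_j U_j(q*_j,c_j) over the capacity region R. -/
theorem cost_minimizer_gives_utility_maximizer
    (J : ℕ) (hJ : 1 ≤ J) (μ : Fin J → ℝ) (hμ : ∀ j, 0 < μ j)
    (U dU : Fin J → ℝ → ℝ → ℝ)
    (hC2 : ∀ j, ContDiffOn ℝ 2 (fun p : ℝ × ℝ => U j p.1 p.2) (Ici 0 ×ˢ Ici 0))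
    (hderiv : ∀ j, ∀ qv c : ℝ, 0 ≤ qv → 0 ≤ c →
      HasDerivWithinAt (U j qv) (dU j qv c) (Ici 0) c)
    (hU1 : ∀ j, ∀ c : ℝ, 0 ≤ c → U j 0 c = 0)
    (hU2mono : ∀ j, ∀ qv : ℝ, 0 < qv → StrictMonoOn (U j qv) (Ici (0 : ℝ)))
    (hU2conc : ∀ j, ∀ qv : ℝ, 0 < qv → StrictConcaveOn ℝ (Ici (0 : ℝ)) (U j qv))
    (hU3 : ∀ j, ∀ c : ℝ, 0 < c → StrictMonoOn (fun qv => dU j qv c) (Ici (0 : ℝ)))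
    (hU4zero : ∀ j, ∀ c : ℝ, 0 < c → dU j 0 c = 0)
    (hU4infty : ∀ j, ∀ c : ℝ, 0 < c → Tendsto (fun qv => dU j qv c) atTop atTop)
    (V : (Fin J → ℝ) → (Fin J → ℝ) → ℝ)
    (hV : ∀ q c : Fin J → ℝ, V q c = ∑ j, (1 / μ j) * ∫ u in (0 : ℝ)..(q j), dU j u (c j))
    (C_U : ℝ) (hCU : 0 < C_U)
    (R : Set (Fin J → ℝ)) (hRsub : R ⊆ {c | (∀ j, 0 ≤ c j) ∧ ∑ j, c j ≤ C_U})
    (ρ : Fin J → ℝ) (hρR : ρ ∈ R) (hρpos : ∀ j, 0 < ρ j)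
    (hρsum : ∑ j, ρ j = C_U)
    (w : ℝ) (hw : 0 < w)
    (qstar : Fin J → ℝ) (hqstar_nonneg : ∀ j, 0 ≤ qstar j)
    (hqstar_feas : w ≤ ∑ j, qstar j / μ j)
    (hqstar_min : ∀ q : Fin J → ℝ, (∀ j, 0 ≤ q j) → w ≤ ∑ j, q j / μ j →
      V qstar ρ ≤ V q ρ) :
    (∀ j, 0 < qstar j) ∧
    (∀ c ∈ R, ∑ j, U j (qstar j) (c j) ≤ ∑ j, U j (qstar j) (ρ j)) := by
  have hmin : ∀ p : Fin J → ℝ, (∀ j, 0 ≤ p j) → w ≤ ∑ j, p j / μ j →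
      ∑ j, (1 / μ j) * ∫ u in (0 : ℝ)..(qstar j), dU j u (ρ j) ≤
        ∑ j, (1 / μ j) * ∫ u in (0 : ℝ)..(p j), dU j u (ρ j) := by
    intro p hp hpw
    rw [← hV, ← hV]
    exact hqstar_min p hp hpw
  have hmarg : ∀ j k, 0 < qstar k → dU k (qstar k) (ρ k) ≤ dU j (qstar j) (ρ j) :=
    fun j k hk => marginal_le_of_isMin (g := fun i u => dU i u (ρ i)) hμ
      (fun i => (hU3 i _ (hρpos i)).monotoneOn)
      (fun i => continuousOn_partial_snd (hC2 i) (hderiv i) (hρpos i).le)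
      hqstar_nonneg hqstar_feas hmin hk
  obtain ⟨k, -, hk⟩ : ∃ k ∈ Finset.univ, 0 < qstar k / μ k :=
    Finset.exists_lt_of_sum_lt (by simpa using hw.trans_le hqstar_feas)
  replace hk : 0 < qstar k := by
    have := mul_pos hk (hμ k)
    rwa [div_mul_cancel₀ _ (hμ k).ne'] at this
  have hlam : 0 < dU k (qstar k) (ρ k) := by
    have := hU3 k _ (hρpos k) self_mem_Ici hk.le hk
    simpa [hU4zero k _ (hρpos k)] using this
  have hpos : ∀ j, 0 < qstar j := by
    intro j
    refine (hqstar_nonneg j).lt_of_ne fun h0 => ?_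
    have := hmarg j k hk
    rw [← h0, hU4zero j _ (hρpos j)] at this
    linarith
  refine ⟨hpos, fun c hc => ?_⟩
  obtain ⟨hc0, hcsum⟩ := hRsub hc
  have htan : ∀ j, U j (qstar j) (c j) ≤
      U j (qstar j) (ρ j) + dU k (qstar k) (ρ k) * (c j - ρ j) := by
    intro j
    rw [(hmarg j k hk).antisymm (hmarg k j (hpos j))]
    exact (hU2conc j _ (hpos j)).concaveOn.le_tangent (hρpos j).le (hc0 j)
      ((hderiv j _ _ (hpos j).le (hρpos j).le).hasDerivAt (Ici_mem_nhds (hρpos j)))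
  calc ∑ j, U j (qstar j) (c j)
      ≤ ∑ j, (U j (qstar j) (ρ j) + dU k (qstar k) (ρ k) * (c j - ρ j)) :=
        Finset.sum_le_sum fun j _ => htan j
    _ = ∑ j, U j (qstar j) (ρ j) + dU k (qstar k) (ρ k) * (∑ j, c j - ∑ j, ρ j) := by
        rw [Finset.sum_add_distrib, ← Finset.mul_sum, Finset.sum_sub_distrib]
    _ ≤ ∑ j, U j (qstar j) (ρ j) := by
        have := mul_nonneg hlam.le (sub_nonneg.2 (hcsum.trans_eq hρsum.symm))
        linarith
end

section
/- Assume (U1)–(U4) and the definitions of C_j, V and CM(w,ρ), and fix ρ ∈ (0,∞)^J. Then for every w ≥ 0 the cost minimization problem CM(w,ρ) has a unique optimal solution q*(w,ρ) ∈ [0,∞)^J, and the map w ↦ q*(w,ρ) is continuous on [0,∞). -/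
open Set Filter

/-- The primitive of a strictly increasing function is strictly convex. -/
theorem strictConvexOn_primitive_of_strictMonoOn {g : ℝ → ℝ} (hg : Monotone g)
    (hgs : StrictMonoOn g (Ici 0)) :
    StrictConvexOn ℝ (Ici 0) (fun q => ∫ u in (0 : ℝ)..q, g u) := by
  have hint : ∀ a b, IntervalIntegrable g MeasureTheory.volume a b :=
    fun a b => hg.intervalIntegrable
  refine strictConvexOn_of_slope_strict_mono_adjacent (convex_Ici 0) ?_
  intro x y z hx _ hxy hyz
  have hx0 : (0 : ℝ) ≤ x := hx
  rw [intervalIntegral.integral_interval_sub_left (hint _ _) (hint _ _),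
    intervalIntegral.integral_interval_sub_left (hint _ _) (hint _ _)]
  have hleft : ∫ u in x..y, g u ≤ g y * (y - x) := by
    have := intervalIntegral.integral_mono_on hxy.le (hint x y)
      (intervalIntegrable_const (c := g y)) (fun u hu => hg hu.2)
    simpa [mul_comm] using this
  have hright : g y * (z - y) < ∫ u in y..z, g u := by
    have hpos : 0 < ∫ u in y..z, (g u - g y) := by
      refine intervalIntegral.intervalIntegral_pos_of_pos_on
        ((hint y z).sub intervalIntegrable_const) (fun u hu => ?_) hyz
      have hy0 : (0 : ℝ) ≤ y := hx0.trans hxy.le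
      exact sub_pos.2 (hgs hy0 (hy0.trans hu.1.le) hu.1)
    rw [intervalIntegral.integral_sub (hint y z) intervalIntegrable_const,
      intervalIntegral.integral_const, smul_eq_mul] at hpos
    linarith [mul_comm (g y) (z - y)]
  exact ((div_le_iff₀ (sub_pos.2 hxy)).2 hleft).trans_lt
    ((lt_div_iff₀ (sub_pos.2 hyz)).2 hright)

/-- The primitive of a nonnegative increasing function is increasing. -/
theorem monotone_primitive_of_nonneg {g : ℝ → ℝ} (hg : Monotone g) (hg0 : ∀ u, 0 ≤ g u) :
    Monotone (fun q => ∫ u in (0 : ℝ)..q, g u) := by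
  intro x y hxy
  have hsub := intervalIntegral.integral_interval_sub_left
    (hg.intervalIntegrable (μ := MeasureTheory.volume) (a := 0) (b := y))
    (hg.intervalIntegrable (a := 0) (b := x))
  have hnn : 0 ≤ ∫ u in x..y, g u :=
    intervalIntegral.integral_nonneg hxy fun u _ => hg0 u
  exact sub_nonneg.1 (hsub ▸ hnn)

/-- A separable sum of strictly convex functions is strictly convex on the nonnegative orthant. -/
theorem strictConvexOn_separable_sum {ι : Type*} [Fintype ι] {F : ι → ℝ → ℝ}
    (hF : ∀ j, StrictConvexOn ℝ (Ici 0) (F j)) :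
    StrictConvexOn ℝ (Ici (0 : ι → ℝ)) (fun q => ∑ j, F j (q j)) := by
  refine ⟨convex_Ici 0, fun x hx y hy hxy a b ha hb hab => ?_⟩
  obtain ⟨i, hi⟩ := Function.ne_iff.1 hxy
  simp only [Finset.smul_sum, ← Finset.sum_add_distrib]
  exact Finset.sum_lt_sum
    (fun j _ => (hF j).convexOn.2 (hx j) (hy j) ha.le hb.le hab)
    ⟨i, Finset.mem_univ i, (hF i).2 (hx i) (hy i) hi ha hb hab⟩

/-- A continuous function that is increasing on the nonnegative orthant attains its minimum over
`{q ≥ 0 | w ≤ ∑ j, q j / μ j}` at a point where the constraint is binding. -/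
theorem exists_binding_minimizer {ι : Type*} [Fintype ι] [Nonempty ι] {μ : ι → ℝ}
    (hμ : ∀ j, 0 < μ j) {φ : (ι → ℝ) → ℝ} (hφ : Continuous φ) (hmono : MonotoneOn φ (Ici 0))
    {w : ℝ} (hw : 0 ≤ w) :
    ∃ p : ι → ℝ, 0 ≤ p ∧ ∑ j, p j / μ j = w ∧
      ∀ q : ι → ℝ, 0 ≤ q → w ≤ ∑ j, q j / μ j → φ p ≤ φ q := by
  set K : Set (ι → ℝ) := {p | 0 ≤ p ∧ ∑ j, p j / μ j = w} with hK
  have hsub : K ⊆ Icc 0 (fun j => w * μ j) := by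
    rintro p ⟨hp, hpw⟩
    refine ⟨hp, fun j => ?_⟩
    rw [← div_le_iff₀ (hμ j), ← hpw]
    exact Finset.single_le_sum (f := fun j => p j / μ j)
      (fun i _ => div_nonneg (hp i) (hμ i).le) (Finset.mem_univ j)
  have hclosed : IsClosed K :=
    isClosed_Ici.inter (isClosed_eq (by fun_prop) continuous_const)
  have hcompact : IsCompact K := isCompact_Icc.of_isClosed_subset hclosed hsub
  have hne : K.Nonempty := by
    classical
    obtain ⟨i⟩ := ‹Nonempty ι›
    refine ⟨Pi.single i (w * μ i), Pi.single_nonneg.2 (mul_nonneg hw (hμ i).le), ?_⟩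
    rw [Finset.sum_eq_single i (fun j _ hj => by simp [hj]) (by simp)]
    simp [(hμ i).ne']
  obtain ⟨p, hp, hmin⟩ := hcompact.exists_isMinOn hne hφ.continuousOn
  refine ⟨p, hp.1, hp.2, fun q hq hwq => ?_⟩
  set S := ∑ j, q j / μ j with hS
  have hS0 : 0 ≤ S := hw.trans hwq
  have ht0 : 0 ≤ w / S := div_nonneg hw hS0
  have ht1 : w / S ≤ 1 := div_le_one_of_le₀ hwq hS0
  have hscaled : 0 ≤ (w / S) • q := smul_nonneg ht0 hq
  have hmem : (w / S) • q ∈ K := by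
    refine ⟨hscaled, ?_⟩
    simp only [Pi.smul_apply, smul_eq_mul, mul_div_assoc, ← Finset.mul_sum]
    rw [← hS]
    rcases hS0.eq_or_lt with h | h
    · rw [← h] at hwq ⊢
      simp [le_antisymm hwq hw]
    · exact div_mul_cancel₀ _ h.ne'
  refine (hmin hmem).trans (hmono hscaled hq fun j => ?_)
  exact mul_le_of_le_one_left (hq j) ht1

/-- Minimizers over `{q ≥ 0 | w ≤ ∑ j, q j / μ j}` of a continuous function that is increasing and
strictly convex on the nonnegative orthant are unique and depend continuously on `w`. -/
theorem exists_continuousOn_unique_minimizer {ι : Type*} [Fintype ι] [Nonempty ι] {μ : ι → ℝ}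
    (hμ : ∀ j, 0 < μ j) {φ : (ι → ℝ) → ℝ} (hφ : Continuous φ) (hmono : MonotoneOn φ (Ici 0))
    (hconv : StrictConvexOn ℝ (Ici 0) φ) :
    ∃ p : ℝ → ι → ℝ,
      (∀ w : ℝ, 0 ≤ w →
        0 ≤ p w ∧ w ≤ ∑ j, p w j / μ j ∧
        (∀ q : ι → ℝ, 0 ≤ q → w ≤ ∑ j, q j / μ j → φ (p w) ≤ φ q) ∧
        (∀ q : ι → ℝ, 0 ≤ q → w ≤ ∑ j, q j / μ j → φ q = φ (p w) → q = p w)) ∧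
      ContinuousOn p (Ici 0) := by
  choose! p hp0 hpw hpmin using
    fun (w : ℝ) (hw : 0 ≤ w) => exists_binding_minimizer hμ hφ hmono hw
  have huniq : ∀ w : ℝ, 0 ≤ w → ∀ q : ι → ℝ, 0 ≤ q → w ≤ ∑ j, q j / μ j →
      φ q = φ (p w) → q = p w := by
    intro w hw q hq hwq heq
    have hfeas : Convex ℝ {x : ι → ℝ | 0 ≤ x ∧ w ≤ ∑ j, x j / μ j} := by
      refine (convex_Ici (0 : ι → ℝ)).inter ?_
      refine convex_halfSpace_ge (f := fun x : ι → ℝ => ∑ j, x j / μ j) ⟨?_, ?_⟩ w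
      · intro x y
        simp [add_div, Finset.sum_add_distrib]
      · intro c x
        simp [mul_div_assoc, Finset.mul_sum]
    refine (hconv.subset (fun x hx => hx.1) hfeas).eq_of_isMinOn (fun x hx => ?_)
      (fun x hx => hpmin w hw x hx.1 hx.2) ⟨hq, hwq⟩ ⟨hp0 w hw, (hpw w hw).ge⟩
    exact heq.le.trans (hpmin w hw x hx.1 hx.2)
  refine ⟨p, fun w hw => ⟨hp0 w hw, (hpw w hw).ge, hpmin w hw, huniq w hw⟩, ?_⟩
  intro w hw
  have hw0 : (0 : ℝ) ≤ w := hw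
  refine (isCompact_Icc (a := (0 : ι → ℝ))
    (b := fun j => (w + 1) * μ j)).tendsto_nhds_of_unique_mapClusterPt ?_ ?_
  · have hnear : ∀ᶠ v in nhdsWithin w (Ici 0), v < w + 1 :=
      (eventually_lt_nhds (lt_add_one w)).filter_mono nhdsWithin_le_nhds
    filter_upwards [self_mem_nhdsWithin, hnear] with v hv hvw
    refine ⟨hp0 v hv, fun j => ?_⟩
    rw [← div_le_iff₀ (hμ j)]
    refine le_trans ?_ ((hpw v hv).trans_le hvw.le)
    exact Finset.single_le_sum (f := fun j => p v j / μ j)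
      (fun i _ => div_nonneg (hp0 v hv i) (hμ i).le) (Finset.mem_univ j)
  · intro y hy hcl
    obtain ⟨𝒰, h𝒰, hlim⟩ := mapClusterPt_iff_ultrafilter.1 hcl
    have hid : Tendsto (fun v : ℝ => v) 𝒰 (nhds w) :=
      tendsto_id.mono_left (h𝒰.trans nhdsWithin_le_nhds)
    have hnn : ∀ᶠ v in (𝒰 : Filter ℝ), 0 ≤ v := h𝒰 self_mem_nhdsWithin
    have hyw : w ≤ ∑ j, y j / μ j := by
      refine le_of_tendsto_of_tendsto hid
        (((by fun_prop : Continuous fun q : ι → ℝ => ∑ j, q j / μ j).tendsto y).comp hlim) ?_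
      filter_upwards [hnn] with v hv using (hpw v hv).ge
    refine huniq w hw0 y hy.1 hyw (le_antisymm ?_ (hpmin w hw0 y hy.1 hyw))
    have hpert : Continuous fun v : ℝ => φ (fun j => p w j + max (v - w) 0 * μ j) := by
      fun_prop
    have hright := (hpert.tendsto w).comp hid
    simp only [sub_self, max_self, zero_mul, add_zero] at hright
    refine le_of_tendsto_of_tendsto ((hφ.tendsto y).comp hlim) hright ?_
    filter_upwards [hnn] with v hv
    have hm : 0 ≤ max (v - w) 0 := le_max_right _ _
    refine hpmin v hv _ (fun j => add_nonneg (hp0 w hw0 j) (mul_nonneg hm (hμ j).le)) ?_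
    have hsum : ∑ j, (p w j + max (v - w) 0 * μ j) / μ j
        = w + Fintype.card ι * max (v - w) 0 := by
      rw [← hpw w hw0]
      simp [add_div, Finset.sum_add_distrib, fun j => (hμ j).ne', hpw w hw0]
    have hcard : (1 : ℝ) ≤ Fintype.card ι := by exact_mod_cast Fintype.card_pos
    show v ≤ ∑ j, (p w j + max (v - w) 0 * μ j) / μ j
    rw [hsum]
    nlinarith [le_max_left (v - w) 0]

/-- for fixed ρ ∈ (0,∞)^J, the cost minimization problem CM(w,ρ)
has a unique optimal solution q*(w,ρ) for each w ≥ 0, and w ↦ q*(w,ρ) is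
continuous on [0,∞). -/
theorem cost_minimizer_exists_unique_and_continuous
    (J : ℕ) (hJ : 1 ≤ J) (μ : Fin J → ℝ) (hμ : ∀ j, 0 < μ j)
    (U dU : Fin J → ℝ → ℝ → ℝ)
    (hC2 : ∀ j, ContDiffOn ℝ 2 (fun p : ℝ × ℝ => U j p.1 p.2) (Ici 0 ×ˢ Ici 0))
    (hderiv : ∀ j, ∀ qv c : ℝ, 0 ≤ qv → 0 ≤ c →
      HasDerivWithinAt (U j qv) (dU j qv c) (Ici 0) c)
    (hU1 : ∀ j, ∀ c : ℝ, 0 ≤ c → U j 0 c = 0)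
    (hU2mono : ∀ j, ∀ qv : ℝ, 0 < qv → StrictMonoOn (U j qv) (Ici (0 : ℝ)))
    (hU2conc : ∀ j, ∀ qv : ℝ, 0 < qv → StrictConcaveOn ℝ (Ici (0 : ℝ)) (U j qv))
    (hU3 : ∀ j, ∀ c : ℝ, 0 < c → StrictMonoOn (fun qv => dU j qv c) (Ici (0 : ℝ)))
    (hU4zero : ∀ j, ∀ c : ℝ, 0 < c → dU j 0 c = 0)
    (hU4infty : ∀ j, ∀ c : ℝ, 0 < c → Tendsto (fun qv => dU j qv c) atTop atTop)
    (V : (Fin J → ℝ) → (Fin J → ℝ) → ℝ)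
    (hV : ∀ q c : Fin J → ℝ, V q c = ∑ j, (1 / μ j) * ∫ u in (0 : ℝ)..(q j), dU j u (c j))
    (ρ : Fin J → ℝ) (hρpos : ∀ j, 0 < ρ j) :
    ∃ qstar : ℝ → Fin J → ℝ,
      (∀ w : ℝ, 0 ≤ w →
        (∀ j, 0 ≤ qstar w j) ∧
        w ≤ ∑ j, qstar w j / μ j ∧
        (∀ q : Fin J → ℝ, (∀ j, 0 ≤ q j) → w ≤ ∑ j, q j / μ j →
          V (qstar w) ρ ≤ V q ρ) ∧
        (∀ q : Fin J → ℝ, (∀ j, 0 ≤ q j) → w ≤ ∑ j, q j / μ j →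
          V q ρ = V (qstar w) ρ → q = qstar w)) ∧
      ContinuousOn qstar (Ici 0) := by
  have : Nonempty (Fin J) := ⟨⟨0, hJ⟩⟩
  set g : Fin J → ℝ → ℝ := fun j u => dU j (max u 0) (ρ j) with hgdef
  have hmono : ∀ j, Monotone (g j) := fun j x y hxy =>
    (hU3 j (ρ j) (hρpos j)).monotoneOn (le_max_right x 0) (le_max_right y 0)
      (max_le_max_right 0 hxy)
  have hstrict : ∀ j, StrictMonoOn (g j) (Ici 0) := by
    intro j x hx y hy hxy
    simp only [hgdef, max_eq_left (mem_Ici.1 hx), max_eq_left (mem_Ici.1 hy)]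
    exact hU3 j (ρ j) (hρpos j) hx hy hxy
  have hnonneg : ∀ j u, 0 ≤ g j u := by
    intro j u
    rw [← hU4zero j (ρ j) (hρpos j)]
    exact (hU3 j (ρ j) (hρpos j)).monotoneOn self_mem_Ici (le_max_right u 0) (le_max_right u 0)
  set F : Fin J → ℝ → ℝ := fun j x => (1 / μ j) * ∫ u in (0 : ℝ)..x, g j u with hF
  have hVF : ∀ q : Fin J → ℝ, 0 ≤ q → V q ρ = ∑ j, F j (q j) := by
    intro q hq
    rw [hV]
    refine Finset.sum_congr rfl fun j _ => ?_
    congr 1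
    refine intervalIntegral.integral_congr fun u hu => ?_
    rw [uIcc_of_le (show (0 : ℝ) ≤ q j from hq j)] at hu
    simp only [hgdef, max_eq_left hu.1]
  have hFcont : ∀ j, Continuous (F j) := fun j => continuous_const.mul
    (intervalIntegral.continuous_primitive (fun a b => (hmono j).intervalIntegrable) 0)
  have hFmono : ∀ j, Monotone (F j) := fun j =>
    (monotone_primitive_of_nonneg (hmono j) (hnonneg j)).const_mul (one_div_pos.2 (hμ j)).le
  have hFconv : ∀ j, StrictConvexOn ℝ (Ici 0) (F j) := by
    intro j
    have h := strictConvexOn_primitive_of_strictMonoOn (hmono j) (hstrict j)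
    refine ⟨h.1, fun x hx y hy hxy a b ha hb hab => ?_⟩
    have hlt := mul_lt_mul_of_pos_left (h.2 hx hy hxy ha hb hab) (one_div_pos.2 (hμ j))
    simp only [hF, smul_eq_mul] at hlt ⊢
    linarith
  obtain ⟨p, hp, hcont⟩ := exists_continuousOn_unique_minimizer hμ
    (φ := fun q => ∑ j, F j (q j))
    (continuous_finsetSum _ fun j _ => (hFcont j).comp (continuous_apply j))
    (fun x _ y _ hxy => Finset.sum_le_sum fun j _ => hFmono j (hxy j))
    (strictConvexOn_separable_sum hFconv)
  refine ⟨p, fun w hw => ?_, hcont⟩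
  obtain ⟨h0, hfeas, hmin, huniq⟩ := hp w hw
  refine ⟨h0, hfeas, fun q hq hqw => ?_, fun q hq hqw heq => huniq q hq hqw ?_⟩
  · rw [hVF _ h0, hVF q hq]
    exact hmin q hq hqw
  · rwa [hVF _ h0, hVF q hq] at heq
end

section
/- Let J ≥ 1, let R ⊆ ℝ^J be any set, let q ∈ (0,∞)^J, and assume for each j that c ↦ U_j(q_j,c) is concave and differentiable on [0,∞). If Λ maximizes c ↦ Σ_{j=1}^J U_j(q_j,c_j) over c ∈ R ∩ [0,∞)^J and ρ ∈ R ∩ [0,∞)^J, then Σ_{j=1}^J (ρ_j − Λ_j) · (∂U_j/∂c)(q_j, ρ_j) ≤ 0. -/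
open Set

/-- A concave function lies below each of its tangent lines. -/
theorem ConcaveOn.le_add_mul_of_hasDerivWithinAt {S : Set ℝ} {f : ℝ → ℝ} {f' x y : ℝ}
    (hf : ConcaveOn ℝ S f) (hx : x ∈ S) (hy : y ∈ S) (hf' : HasDerivWithinAt f f' S x) :
    f y ≤ f x + (y - x) * f' := by
  rcases lt_trichotomy x y with h | rfl | h
  · have hs := hf.slope_le_of_hasDerivWithinAt hx hy h hf'
    rw [slope_def_field, div_le_iff₀ (sub_pos.2 h)] at hs
    linarith
  · simp
  · have hs := hf.le_slope_of_hasDerivWithinAt hy hx h hf'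
    rw [slope_def_field, le_div_iff₀ (sub_pos.2 h)] at hs
    linarith

/-- first-order optimality inequality for the utility-maximizing
allocation Λ: for every ρ in the feasible set,
Σ_j (ρ_j − Λ_j)·(∂U_j/∂c)(q_j,ρ_j) ≤ 0. -/
theorem first_order_optimality_inequality
    (J : ℕ) (hJ : 1 ≤ J) (U dU : Fin J → ℝ → ℝ → ℝ)
    (R : Set (Fin J → ℝ))
    (q : Fin J → ℝ) (hq : ∀ j, 0 < q j)
    (hconc : ∀ j, ConcaveOn ℝ (Ici (0 : ℝ)) (U j (q j)))
    (hderiv : ∀ j, ∀ c : ℝ, 0 ≤ c →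
      HasDerivWithinAt (U j (q j)) (dU j (q j) c) (Ici 0) c)
    (Λ : Fin J → ℝ) (hΛ : Λ ∈ R ∩ {c | ∀ j, 0 ≤ c j})
    (hmax : ∀ c ∈ R ∩ {c : Fin J → ℝ | ∀ j, 0 ≤ c j},
      ∑ j, U j (q j) (c j) ≤ ∑ j, U j (q j) (Λ j))
    (ρ : Fin J → ℝ) (hρ : ρ ∈ R ∩ {c | ∀ j, 0 ≤ c j}) :
    ∑ j, (ρ j - Λ j) * dU j (q j) (ρ j) ≤ 0 := by
  calc
    ∑ j, (ρ j - Λ j) * dU j (q j) (ρ j)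
        ≤ ∑ j, (U j (q j) (ρ j) - U j (q j) (Λ j)) :=
      Finset.sum_le_sum fun j _ => by
        linarith [(hconc j).le_add_mul_of_hasDerivWithinAt (hρ.2 j) (hΛ.2 j)
          (hderiv j (ρ j) (hρ.2 j))]
    _ ≤ 0 := by
      rw [Finset.sum_sub_distrib]
      exact sub_nonpos.2 (hmax ρ hρ)
end

section
/- Assume (U1)–(U4) and the definitions of C_j, V and CM(w,ρ). Let R ⊆ [0,∞)^J be a compact convex set containing the origin, with C_U := max_{c ∈ R} Σ_{j=1}^J c_j > 0, and let ρ ∈ R lie in the relative interior of the sum-capacity facet of R: ρ_j > 0 for all j, Σ_j ρ_j = C_U, and there exists δ > 0 such that every c ∈ [0,∞)^J with Σ_j c_j = C_U and Σ_j |c_j − ρ_j| < δ belongs to R. For q ∈ (0,∞)^J let Λ(q) denote the unique maximizer of c ↦ Σ_{j=1}^J U_j(q_j,c_j) over c ∈ R, let w(q) := Σ_{j=1}^J q_j/μ_j, let q*(w,ρ) denote the unique optimal solution of CM(w,ρ), and define h(q) := Σ_{j=1}^J (ρ_j − Λ_j(q)) · (∂U_j/∂c)(q_j, ρ_j). Then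 h(q) ≤ 0 for every q ∈ (0,∞)^J, and h(q) = 0 if and only if q = q*(w(q), ρ). -/
open Set Filter

open Topology MeasureTheory

/-- First-order condition for a separable function along a line. -/
lemma sum_deriv_mul_direction_eq_zero {ι : Type*} [Fintype ι] {f : ι → ℝ → ℝ} {f' x d : ι → ℝ}
    (hf : ∀ k, HasDerivAt (f k) (f' k) (x k))
    (hmin : ∀ᶠ t in 𝓝 (0 : ℝ), ∑ k, f k (x k) ≤ ∑ k, f k (x k + t * d k)) :
    ∑ k, f' k * d k = 0 := by
  have hderiv : HasDerivAt (fun t : ℝ => ∑ k, f k (x k + t * d k)) (∑ k, f' k * d k) 0 := by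
    refine HasDerivAt.fun_sum fun k _ => ?_
    have hline : HasDerivAt (fun t : ℝ => x k + t * d k) (d k) 0 := by
      simpa using ((hasDerivAt_id (0 : ℝ)).mul_const (d k)).const_add (x k)
    exact HasDerivAt.comp (0 : ℝ) (by simpa using hf k) hline
  refine IsLocalMin.hasDerivAt_eq_zero ?_ hderiv
  filter_upwards [hmin] with t ht
  simpa using ht

/-- Small perturbations of a strictly positive vector stay nonnegative. -/
lemma eventually_forall_nonneg_add_mul {ι : Type*} [Finite ι] {x : ι → ℝ} (hx : ∀ k, 0 < x k)
    (d : ι → ℝ) : ∀ᶠ t in 𝓝 (0 : ℝ), ∀ k, 0 ≤ x k + t * d k := by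
  refine eventually_all.2 fun k => ?_
  have hcont : ContinuousAt (fun t : ℝ => x k + t * d k) 0 := by fun_prop
  filter_upwards [hcont.eventually (lt_mem_nhds (by simpa using hx k))] with t ht using ht.le

/-- A differentiable concave function lies below its tangent lines. -/
lemma ConcaveOn.le_add_mul_of_hasDerivAt {S : Set ℝ} {f : ℝ → ℝ} {f' x y : ℝ}
    (hf : ConcaveOn ℝ S f) (hx : x ∈ S) (hy : y ∈ S) (hderiv : HasDerivAt f f' x) :
    f y ≤ f x + f' * (y - x) := by
  rcases lt_trichotomy x y with h | rfl | h
  · have hs := hf.slope_le_of_hasDerivAt hx hy h hderiv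
    rw [slope_def_field, div_le_iff₀ (sub_pos.2 h)] at hs
    linarith
  · simp
  · have hs := hf.le_slope_of_hasDerivAt hy hx h hderiv
    rw [slope_def_field, le_div_iff₀ (sub_pos.2 h)] at hs
    linarith

/-- The primitive of a monotone function lies above its tangent lines. -/
lemma MonotoneOn.mul_sub_le_integral {f : ℝ → ℝ} (hf : MonotoneOn f (Ici 0)) {a b : ℝ}
    (ha : 0 ≤ a) (hb : 0 ≤ b) :
    f a * (b - a) ≤ (∫ u in (0 : ℝ)..b, f u) - ∫ u in (0 : ℝ)..a, f u := by
  have hint : ∀ x y : ℝ, 0 ≤ x → 0 ≤ y → IntervalIntegrable f volume x y := fun x y hx hy =>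
    (hf.mono fun z hz => (le_inf hx hy).trans hz.1).intervalIntegrable
  rw [intervalIntegral.integral_interval_sub_left (hint 0 b le_rfl hb) (hint 0 a le_rfl ha)]
  rcases le_total a b with h | h
  · have := intervalIntegral.integral_mono_on h intervalIntegrable_const (hint a b ha hb)
      (fun u hu => hf ha (ha.trans hu.1) hu.1)
    rw [intervalIntegral.integral_const, smul_eq_mul] at this
    linarith
  · have := intervalIntegral.integral_mono_on h (hint b a hb ha) intervalIntegrable_const
      (fun u hu => hf (hb.trans hu.1) ha hu.2)
    rw [intervalIntegral.integral_const, smul_eq_mul] at this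
    rw [intervalIntegral.integral_symm]
    linarith

/-- The partial derivative in the second variable of a `C²` function on the closed quadrant is
continuous in the first variable on the open half-line. -/
lemma continuousOn_partialDeriv_snd {F D : ℝ → ℝ → ℝ}
    (hF : ContDiffOn ℝ 2 (fun p : ℝ × ℝ => F p.1 p.2) (Ici 0 ×ˢ Ici 0)) {c : ℝ} (hc : 0 < c)
    (hD : ∀ x, 0 < x → HasDerivAt (F x) (D x c) c) :
    ContinuousOn (fun x => D x c) (Ioi 0) := by
  have hopen : IsOpen (Ioi (0 : ℝ) ×ˢ Ioi (0 : ℝ)) := isOpen_Ioi.prod isOpen_Ioi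
  have hF' := hF.mono (prod_mono Ioi_subset_Ici_self Ioi_subset_Ici_self)
  have hcont := hF'.continuousOn_fderiv_of_isOpen hopen (by norm_num)
  have hcomp : ContinuousOn
      (fun x : ℝ => fderiv ℝ (fun p : ℝ × ℝ => F p.1 p.2) (x, c) (0, 1)) (Ioi 0) :=
    (hcont.comp (f := fun x : ℝ => (x, c)) (by fun_prop)
      fun x hx => ⟨hx, hc⟩).clm_apply continuousOn_const
  refine hcomp.congr fun x hx => ?_
  have hdiff : DifferentiableAt ℝ (fun p : ℝ × ℝ => F p.1 p.2) (x, c) :=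
    (hF'.contDiffAt (hopen.mem_nhds (mk_mem_prod hx hc))).differentiableAt (by norm_num)
  have hline : HasDerivAt (fun y : ℝ => (x, y)) ((0 : ℝ), (1 : ℝ)) c :=
    (hasDerivAt_const c x).prodMk (hasDerivAt_id c)
  exact (hD x hx).unique (hdiff.hasFDerivAt.comp_hasDerivAt c hline)

/-- the drift functional
h(q) = Σ_j (ρ_j − Λ_j(q))·(∂U_j/∂c)(q_j,ρ_j) is nonpositive on the positive
orthant, and vanishes exactly at the fixed point q = q*(w(q),ρ). -/
theorem drift_nonpositive_and_vanishes_iff_fixed_point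
    (J : ℕ) (hJ : 1 ≤ J) (μ : Fin J → ℝ) (hμ : ∀ j, 0 < μ j)
    (U dU : Fin J → ℝ → ℝ → ℝ)
    (hC2 : ∀ j, ContDiffOn ℝ 2 (fun p : ℝ × ℝ => U j p.1 p.2) (Ici 0 ×ˢ Ici 0))
    (hderiv : ∀ j, ∀ qv c : ℝ, 0 ≤ qv → 0 ≤ c →
      HasDerivWithinAt (U j qv) (dU j qv c) (Ici 0) c)
    (hU1 : ∀ j, ∀ c : ℝ, 0 ≤ c → U j 0 c = 0)
    (hU2mono : ∀ j, ∀ qv : ℝ, 0 < qv → StrictMonoOn (U j qv) (Ici (0 : ℝ)))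
    (hU2conc : ∀ j, ∀ qv : ℝ, 0 < qv → StrictConcaveOn ℝ (Ici (0 : ℝ)) (U j qv))
    (hU3 : ∀ j, ∀ c : ℝ, 0 < c → StrictMonoOn (fun qv => dU j qv c) (Ici (0 : ℝ)))
    (hU4zero : ∀ j, ∀ c : ℝ, 0 < c → dU j 0 c = 0)
    (hU4infty : ∀ j, ∀ c : ℝ, 0 < c → Tendsto (fun qv => dU j qv c) atTop atTop)
    (V : (Fin J → ℝ) → (Fin J → ℝ) → ℝ)
    (hV : ∀ q c : Fin J → ℝ, V q c = ∑ j, (1 / μ j) * ∫ u in (0 : ℝ)..(q j), dU j u (c j))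
    -- the capacity region
    (R : Set (Fin J → ℝ)) (hRsub : R ⊆ {c | ∀ j, 0 ≤ c j})
    (hRcomp : IsCompact R) (hRconv : Convex ℝ R) (hR0 : (0 : Fin J → ℝ) ∈ R)
    (C_U : ℝ) (hCUpos : 0 < C_U) (hCUub : ∀ c ∈ R, ∑ j, c j ≤ C_U)
    (ρ : Fin J → ℝ) (hρR : ρ ∈ R) (hρpos : ∀ j, 0 < ρ j) (hρsum : ∑ j, ρ j = C_U)
    (hfacet : ∃ δ > 0, ∀ c : Fin J → ℝ, (∀ j, 0 ≤ c j) → ∑ j, c j = C_U →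
      ∑ j, |c j - ρ j| < δ → c ∈ R)
    -- Λ q : the unique utility maximizer over R for q ∈ (0,∞)^J
    (Λ : (Fin J → ℝ) → (Fin J → ℝ))
    (hΛmem : ∀ q : Fin J → ℝ, (∀ j, 0 < q j) → Λ q ∈ R)
    (hΛmax : ∀ q : Fin J → ℝ, (∀ j, 0 < q j) →
      ∀ c ∈ R, ∑ j, U j (q j) (c j) ≤ ∑ j, U j (q j) (Λ q j))
    (hΛuniq : ∀ q : Fin J → ℝ, (∀ j, 0 < q j) →
      ∀ c ∈ R, (∀ c' ∈ R, ∑ j, U j (q j) (c' j) ≤ ∑ j, U j (q j) (c j)) → c = Λ q)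
    -- q* : the unique optimal solution of CM(·,ρ)
    (qstar : ℝ → Fin J → ℝ)
    (hqstar : ∀ w : ℝ, 0 ≤ w →
      (∀ j, 0 ≤ qstar w j) ∧
      w ≤ ∑ j, qstar w j / μ j ∧
      (∀ q : Fin J → ℝ, (∀ j, 0 ≤ q j) → w ≤ ∑ j, q j / μ j →
        V (qstar w) ρ ≤ V q ρ) ∧
      (∀ q : Fin J → ℝ, (∀ j, 0 ≤ q j) → w ≤ ∑ j, q j / μ j →
        V q ρ = V (qstar w) ρ → q = qstar w)) :
    ∀ q : Fin J → ℝ, (∀ j, 0 < q j) →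
      (∑ j, (ρ j - Λ q j) * dU j (q j) (ρ j) ≤ 0) ∧
      (∑ j, (ρ j - Λ q j) * dU j (q j) (ρ j) = 0 ↔ q = qstar (∑ j, q j / μ j)) := by
  intro q hq
  have hdU : ∀ j, ∀ x, 0 ≤ x → HasDerivAt (U j x) (dU j x (ρ j)) (ρ j) := fun j x hx =>
    (hderiv j x (ρ j) hx (hρpos j).le).hasDerivAt (Ici_mem_nhds (hρpos j))
  have hp : ∀ j, 0 < dU j (q j) (ρ j) := fun j => by
    simpa [hU4zero j _ (hρpos j)] using
      hU3 j (ρ j) (hρpos j) (mem_Ici.2 le_rfl) (mem_Ici.2 (hq j).le) (hq j)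
  have htangent : ∀ c ∈ R, ∑ j, U j (q j) (c j) ≤
      ∑ j, U j (q j) (ρ j) + ∑ j, dU j (q j) (ρ j) * (c j - ρ j) := by
    intro c hc
    rw [← Finset.sum_add_distrib]
    exact Finset.sum_le_sum fun j _ => (hU2conc j (q j) (hq j)).concaveOn.le_add_mul_of_hasDerivAt
      (hρpos j).le (hRsub hc j) (hdU j (q j) (hq j).le)
  have hdrift : ∑ j, (ρ j - Λ q j) * dU j (q j) (ρ j) =
      -∑ j, dU j (q j) (ρ j) * (Λ q j - ρ j) := by
    rw [← Finset.sum_neg_distrib]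
    exact Finset.sum_congr rfl fun j _ => by ring
  have hΛtangent := htangent _ (hΛmem q hq)
  have hρmax := hΛmax q hq ρ hρR
  have hq0 : ∀ j, 0 ≤ q j := fun j => (hq j).le
  have hw0 : 0 ≤ ∑ j, q j / μ j := Finset.sum_nonneg fun j _ => div_nonneg (hq0 j) (hμ j).le
  obtain ⟨hs0, hsw, hsmin, hsuniq⟩ := hqstar _ hw0
  refine ⟨by linarith, ?_, ?_⟩
  · intro hzero
    -- `ρ` maximizes the utility, so the marginal utilities at `ρ` coincide
    have heq : ∀ i k, dU i (q i) (ρ i) = dU k (q k) (ρ k) := by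
      intro i k
      obtain ⟨δ, hδ, hball⟩ := hfacet
      set d : Fin J → ℝ := Pi.single i 1 - Pi.single k 1 with hd
      have hdsum : ∑ j, d j = 0 := by simp [hd]
      have hsmall : ∀ᶠ t in 𝓝 (0 : ℝ), ∑ j, |ρ j + t * d j - ρ j| < δ := by
        have hcont : ContinuousAt (fun t : ℝ => ∑ j, |ρ j + t * d j - ρ j|) 0 := by fun_prop
        exact hcont.eventually (gt_mem_nhds (by simpa using hδ))
      have hfoc := sum_deriv_mul_direction_eq_zero (f := fun j c => -U j (q j) c) (d := d)
        (fun j => (hdU j (q j) (hq0 j)).neg) (by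
          filter_upwards [hsmall, eventually_forall_nonneg_add_mul hρpos d] with t ht1 ht2
          have hmem : (fun j => ρ j + t * d j) ∈ R := hball _ ht2
            (by rw [Finset.sum_add_distrib, ← Finset.mul_sum, hdsum, hρsum]; ring) ht1
          have hle := hΛmax q hq _ hmem
          simp only [Finset.sum_neg_distrib]
          linarith)
      simp [hd, mul_sub, Finset.sum_sub_distrib, Pi.single_apply] at hfoc
      linarith
    -- equal marginal utilities make `q` optimal for the cost minimization problem
    have hle : V q ρ ≤ V (qstar (∑ j, q j / μ j)) ρ := by
      set s := qstar (∑ j, q j / μ j)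
      let i : Fin J := ⟨0, hJ⟩
      have hterm : ∀ j, dU i (q i) (ρ i) * (s j / μ j - q j / μ j) ≤
          (1 / μ j) * (∫ u in (0 : ℝ)..(s j), dU j u (ρ j)) -
            (1 / μ j) * ∫ u in (0 : ℝ)..(q j), dU j u (ρ j) := by
        intro j
        have hmono := (hU3 j (ρ j) (hρpos j)).monotoneOn.mul_sub_le_integral (hq0 j) (hs0 j)
        have hmul := mul_le_mul_of_nonneg_left hmono (one_div_nonneg.2 (hμ j).le)
        rw [heq i j, ← mul_sub]
        refine le_of_eq_of_le ?_ hmul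
        ring
      have hsum := Finset.sum_le_sum fun j (_ : j ∈ Finset.univ) => hterm j
      rw [← Finset.mul_sum, Finset.sum_sub_distrib, Finset.sum_sub_distrib, ← hV, ← hV] at hsum
      have := mul_nonneg (hp i).le (sub_nonneg.2 hsw)
      linarith
    exact hsuniq q hq0 le_rfl (le_antisymm hle (hsmin q hq0 le_rfl))
  · intro hfix
    rw [← hfix] at hsmin
    -- optimality of `q` forces equal marginal costs, hence equal marginal utilities at `ρ`
    have hprim : ∀ j, HasDerivAt (fun x => (1 / μ j) * ∫ u in (0 : ℝ)..x, dU j u (ρ j))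
        ((1 / μ j) * dU j (q j) (ρ j)) (q j) := by
      intro j
      have hcont := continuousOn_partialDeriv_snd (hC2 j) (hρpos j) fun x hx => hdU j x hx.le
      refine (intervalIntegral.integral_hasDerivAt_right ?_
        (hcont.stronglyMeasurableAtFilter isOpen_Ioi _ (hq j))
        (hcont.continuousAt (Ioi_mem_nhds (hq j)))).const_mul _
      exact ((hU3 j (ρ j) (hρpos j)).monotoneOn.mono
        fun z hz => (le_inf le_rfl (hq0 j)).trans hz.1).intervalIntegrable
    have heq : ∀ i k, dU i (q i) (ρ i) = dU k (q k) (ρ k) := by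
      intro i k
      set d : Fin J → ℝ := Pi.single i (μ i) - Pi.single k (μ k) with hd
      have hdsum : ∑ j, d j / μ j = 0 := by
        simp [hd, sub_div, Finset.sum_sub_distrib, Pi.single_apply, ite_div, (hμ _).ne']
      have hfoc := sum_deriv_mul_direction_eq_zero (d := d) hprim (by
          filter_upwards [eventually_forall_nonneg_add_mul hq d] with t ht
          have hle := hsmin (fun j => q j + t * d j) ht (by
            simp only [add_div, mul_div_assoc, Finset.sum_add_distrib, ← Finset.mul_sum, hdsum]
            simp)
          rwa [hV, hV] at hle)
      have hi := (hμ i).ne'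
      have hk := (hμ k).ne'
      simp [hd, mul_sub, Finset.sum_sub_distrib, Pi.single_apply] at hfoc
      field_simp at hfoc
      linarith
    have hmax : ∀ c ∈ R, ∑ j, U j (q j) (c j) ≤ ∑ j, U j (q j) (ρ j) := by
      intro c hc
      let i : Fin J := ⟨0, hJ⟩
      have hlin : ∑ j, dU j (q j) (ρ j) * (c j - ρ j) = dU i (q i) (ρ i) * (∑ j, c j - C_U) := by
        rw [← hρsum, ← Finset.sum_sub_distrib, Finset.mul_sum]
        exact Finset.sum_congr rfl fun j _ => by rw [heq i j]
      have := mul_nonneg (hp i).le (sub_nonneg.2 (hCUub c hc))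
      have := htangent c hc
      linarith
    rw [← hΛuniq q hq ρ hρR hmax]
    simp
end

section
/- Let x : [0,∞) → ℝ be continuous with x(0) ≥ 0, and define y(t) := sup_{0 ≤ s ≤ t} max(−x(s), 0) and w := x + y. Then: (i) w(t) ≥ 0 for all t; (ii) y is continuous, nondecreasing, and y(0) = 0; (iii) y increases only at times where w vanishes, in the sense that for all 0 ≤ s ≤ t, if w(u) > 0 for every u ∈ [s,t] then y(s) = y(t). Moreover, this solution of the one-dimensional Skorohod (reflection) problem is unique: if ỹ : [0,∞) → ℝ is continuous, nondecreasing, ỹ(0) = 0, the function w̃ := x + ỹ is nonnegative, and for all 0 ≤ s ≤ t with w̃(u) > 0 for every u ∈ [s,t] one has ỹ(s) = ỹ(t), then ỹ = y and w̃ = w. -/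
open Set

theorem continuousOn_sSup_image_Icc {g : ℝ → ℝ} (hg : ContinuousOn g (Ici 0)) :
    ContinuousOn (fun t => sSup (g '' Icc 0 t)) (Ici 0) := by
  have hext : Continuous fun t => g (max t 0) :=
    hg.comp_continuous (by fun_prop) fun t => le_max_right t 0
  have hsup : Continuous fun t : ℝ => sSup ((fun r => g (max (t * r) 0)) '' Icc (0 : ℝ) 1) :=
    isCompact_Icc.continuous_sSup (f := fun t r : ℝ => g (max (t * r) 0))
      (hext.comp continuous_mul)
  refine hsup.continuousOn.congr fun t ht => ?_
  have ht : 0 ≤ t := ht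
  have hIcc : (fun r => t * r) '' Icc (0 : ℝ) 1 = Icc 0 t := by
    rcases ht.eq_or_lt with rfl | ht
    · simp
    · simpa using image_mul_left_Icc' ht 0 1
  change sSup (g '' Icc 0 t) = sSup _
  rw [← hIcc, image_image]
  congr 1
  refine image_congr fun r hr => ?_
  rw [max_eq_left (mul_nonneg ht hr.1)]

/-- existence and uniqueness for the one-dimensional Skorohod
reflection problem: with y(t) = sup_{0≤s≤t} max(−x(s),0) and w = x + y, the
pair (w,y) solves the reflection problem, and it is the unique solution. -/
theorem skorohod_problem_existence_uniqueness
    (x : ℝ → ℝ) (hx : ContinuousOn x (Ici 0)) (hx0 : 0 ≤ x 0)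
    (y w : ℝ → ℝ)
    (hy : ∀ t : ℝ, y t = sSup ((fun s => max (-x s) 0) '' Icc 0 t))
    (hw : ∀ t : ℝ, w t = x t + y t) :
    -- (i) nonnegativity of the reflected path
    (∀ t : ℝ, 0 ≤ t → 0 ≤ w t) ∧
    -- (ii) y is continuous, nondecreasing, and starts at 0
    ContinuousOn y (Ici 0) ∧ MonotoneOn y (Ici 0) ∧ y 0 = 0 ∧
    -- (iii) y increases only when w vanishes
    (∀ s t : ℝ, 0 ≤ s → s ≤ t → (∀ u ∈ Icc s t, 0 < w u) → y s = y t) ∧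
    -- uniqueness
    (∀ ytil : ℝ → ℝ, ContinuousOn ytil (Ici 0) → MonotoneOn ytil (Ici 0) →
      ytil 0 = 0 → (∀ t : ℝ, 0 ≤ t → 0 ≤ x t + ytil t) →
      (∀ s t : ℝ, 0 ≤ s → s ≤ t → (∀ u ∈ Icc s t, 0 < x u + ytil u) →
        ytil s = ytil t) →
      ∀ t : ℝ, 0 ≤ t → ytil t = y t ∧ x t + ytil t = w t) := by
  have hg : ContinuousOn (fun s => max (-x s) 0) (Ici 0) := hx.neg.sup continuousOn_const
  have hgt (t : ℝ) : ContinuousOn (fun s => max (-x s) 0) (Icc 0 t) :=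
    hg.mono Icc_subset_Ici_self
  have hle {s t : ℝ} (hs : 0 ≤ s) (hst : s ≤ t) : max (-x s) 0 ≤ y t := by
    rw [hy]
    exact le_csSup (isCompact_Icc.image_of_continuousOn (hgt t)).bddAbove ⟨s, ⟨hs, hst⟩, rfl⟩
  have hatt {t : ℝ} (ht : 0 ≤ t) : ∃ r ∈ Icc 0 t, y t = max (-x r) 0 := by
    obtain ⟨r, hr, h⟩ := isCompact_Icc.exists_sSup_image_eq (nonempty_Icc.2 ht) (hgt t)
    exact ⟨r, hr, (hy t).trans h⟩
  have hmono : MonotoneOn y (Ici 0) := by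
    intro s hs t _ hst
    obtain ⟨r, hr, h⟩ := hatt hs
    exact h.trans_le (hle hr.1 (hr.2.trans hst))
  have hynonneg {t : ℝ} (ht : 0 ≤ t) : 0 ≤ y t := (le_max_right _ _).trans (hle ht le_rfl)
  have hwnonneg {t : ℝ} (ht : 0 ≤ t) : 0 ≤ x t + y t := by
    linarith [(le_max_left (-x t) 0).trans (hle ht le_rfl)]
  refine ⟨fun t ht => (hw t).symm ▸ hwnonneg ht, ?_, hmono, ?_, ?_, ?_⟩
  · rw [funext hy]
    exact continuousOn_sSup_image_Icc hg
  · simp [hy, hx0]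
  · intro s t hs hst hpos
    refine (hmono hs (hs.trans hst) hst).antisymm (not_lt.1 fun hlt => ?_)
    obtain ⟨r, hr, h⟩ := hatt (hs.trans hst)
    have hsr : s ≤ r := by
      by_contra! hrs
      exact hlt.not_ge (h.trans_le (hle hr.1 hrs.le))
    have hxr : y t = -x r := by
      rcases max_choice (-x r) 0 with h' | h'
      · rw [h, h']
      · linarith [hynonneg hs]
    have hwr := hpos r ⟨hsr, hr.2⟩
    rw [hw] at hwr
    linarith [hmono hr.1 (hs.trans hst) hr.2]
  · intro z hz hzmono hz0 hznonneg hzflat t ht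
    have hyz : y t ≤ z t := by
      obtain ⟨r, hr, h⟩ := hatt ht
      rw [h]
      refine max_le ?_ (hz0 ▸ hzmono self_mem_Ici ht ht)
      linarith [hznonneg r hr.1, hzmono hr.1 ht hr.2]
    have hzy : z t ≤ y t := by
      by_contra! hlt
      obtain ⟨c, hyc, hcz⟩ := exists_between hlt
      obtain ⟨s, hs, rfl⟩ := intermediate_value_Icc ht (hz.mono Icc_subset_Ici_self)
        ⟨hz0.trans_le ((hynonneg ht).trans hyc.le), hcz.le⟩
      refine hcz.ne (hzflat s t hs.1 hs.2 fun u hu => ?_)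
      have hu0 : 0 ≤ u := hs.1.trans hu.1
      linarith [hwnonneg hu0, hmono hu0 ht hu.2, hzmono hs.1 hu0 hu.1]
    have hzt : z t = y t := hzy.antisymm hyz
    exact ⟨hzt, by rw [hw, hzt]⟩
end

section
/- Let x : [0,∞) → ℝ be continuous with x(0) ≥ 0, and define y(t) := sup_{0 ≤ s ≤ t} max(−x(s), 0) and w := x + y (the reflected path). Then the pair (w,y) is minimal in the following sense: for every nondecreasing function ỹ : [0,∞) → ℝ with ỹ(0) ≥ 0 such that x(t) + ỹ(t) ≥ 0 for all t ≥ 0, one has ỹ(t) ≥ y(t), and hence x(t) + ỹ(t) ≥ w(t), for all t ≥ 0. -/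
open Set

/-- minimality of the one-dimensional Skorohod reflection: every
nondecreasing ỹ with ỹ(0) ≥ 0 keeping x + ỹ nonnegative dominates the
regulator y, and hence x + ỹ dominates the reflected path w. -/
theorem skorohod_reflection_minimality
    (x : ℝ → ℝ) (hx : ContinuousOn x (Ici 0)) (hx0 : 0 ≤ x 0)
    (y w : ℝ → ℝ)
    (hy : ∀ t : ℝ, y t = sSup ((fun s => max (-x s) 0) '' Icc 0 t))
    (hw : ∀ t : ℝ, w t = x t + y t)
    (ytil : ℝ → ℝ) (hytil_mono : MonotoneOn ytil (Ici 0))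
    (hytil0 : 0 ≤ ytil 0)
    (hytil_nonneg : ∀ t : ℝ, 0 ≤ t → 0 ≤ x t + ytil t) :
    ∀ t : ℝ, 0 ≤ t → y t ≤ ytil t ∧ w t ≤ x t + ytil t := by
  intro t ht
  have hle : y t ≤ ytil t := by
    rw [hy]
    refine csSup_le ((nonempty_Icc.2 ht).image _) ?_
    rintro _ ⟨s, ⟨hs0, hst⟩, rfl⟩
    have hs := hytil_nonneg s hs0
    have hmono := hytil_mono (mem_Ici.2 hs0) (mem_Ici.2 ht) hst
    have h0 := hytil_mono (mem_Ici.2 le_rfl) (mem_Ici.2 ht) ht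
    exact max_le (by linarith) (hytil0.trans h0)
  exact ⟨hle, by rw [hw]; linarith⟩
end
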